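/- arXiv:1603.04180 — 2 statements merged into one kernel-verified Lean document; each statement's English description precedes it below -/
import Mathlib

section
/- For all integers k ≥ 3 and 1 ≤ ℓ < k/2 and every γ > 0 there exists n₀ such that every k-uniform hypergraph H = (V,E) on n ≥ n₀ vertices with n divisible by k−ℓ and δ_{k−1}(H) ≥ (1/(2(k−ℓ)) + γ)·n contains a Hamiltonian ℓ-cycle. -/
open Finset

/-- Number of edges of the hypergraph `E` containing the vertex set `S`. -/
def degH {n : ℕ} (E : Finset (Finset (Fin n))) (S : Finset (Fin n)) : ℕ :=
  (E.filter fun e => S ⊆ e).card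

/-- `E` contains a Hamiltonian ℓ-cycle. -/
def HasHamCycle {n : ℕ} (k l : ℕ) (E : Finset (Finset (Fin n))) : Prop :=
  ∃ vs : List (Fin n), vs.Nodup ∧ (∀ v, v ∈ vs) ∧ 1 ≤ vs.length / (k - l) ∧
    ∀ i < vs.length / (k - l), ((vs.rotate (i * (k - l))).take k).toFinset ∈ E

set_option linter.unusedSimpArgs false

/-- `Spans k l E A B X`: the set `X` is the vertex set of an `l`-path of `E` whose first `l` vertices
form the set `A` and whose last `l` vertices form the set `B`. -/
inductive Spans {V : Type*} [DecidableEq V] (k l : ℕ) (E : Finset (Finset V)) :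
    Finset V → Finset V → Finset V → Prop
  | base (A : Finset V) (hA : A.card = l) : Spans k l E A A A
  | step {A B X A' Z : Finset V} (h : Spans k l E A B X) (hA' : A'.card = l)
      (hZ : Z.card = k - 2 * l) (hd : Disjoint A' Z) (hX : Disjoint (A' ∪ Z) X)
      (he : A' ∪ Z ∪ A ∈ E) : Spans k l E A' B (A' ∪ Z ∪ X)

section Spans
variable {V : Type*} [DecidableEq V] {k l : ℕ} {E : Finset (Finset V)}

lemma Spans.card_left {A B X : Finset V} (h : Spans k l E A B X) : A.card = l := by
  cases h <;> assumption

lemma Spans.card_right {A B X : Finset V} (h : Spans k l E A B X) : B.card = l := by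
  induction h <;> assumption

lemma Spans.left_subset {A B X : Finset V} (h : Spans k l E A B X) : A ⊆ X := by
  cases h with
  | base => exact subset_rfl
  | step => exact (subset_union_left.trans subset_union_left)

lemma Spans.right_subset {A B X : Finset V} (h : Spans k l E A B X) : B ⊆ X := by
  induction h with
  | base => exact subset_rfl
  | step _ _ _ _ _ _ ih => exact ih.trans subset_union_right

lemma Spans.card_eq (hl : 2 * l < k) {A B X : Finset V} (h : Spans k l E A B X) :
    ∃ m, X.card = m * (k - l) + l := by
  induction h with
  | base A hA => exact ⟨0, by simpa using hA⟩
  | step _ hA' hZ hd hX _ ih =>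
    obtain ⟨m, hm⟩ := ih
    refine ⟨m + 1, ?_⟩
    rw [card_union_of_disjoint hX, card_union_of_disjoint hd, hm, hA', hZ, add_mul]
    omega

lemma Spans.join {A B C D X Y Z : Finset V} (h : Spans k l E A B X) (h' : Spans k l E C D Y)
    (hZ : Z.card = k - 2 * l) (hXZ : Disjoint X Z) (hXY : Disjoint X Y) (hZY : Disjoint Z Y)
    (he : B ∪ Z ∪ C ∈ E) : Spans k l E A D (X ∪ Z ∪ Y) := by
  induction h with
  | base A hA => exact .step h' hA hZ hXZ (disjoint_union_left.2 ⟨hXY, hZY⟩) he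
  | @step A₀ B₀ X₀ A' Z' h hA' hZ' hd hX he' ih =>
    rw [disjoint_union_left] at hXZ hXY
    have := ih hXZ.2 hXY.2 he
    have h2 := Spans.step this hA' hZ' hd (by
      rw [disjoint_union_right, disjoint_union_right]
      exact ⟨⟨hX, hXZ.1⟩, hXY.1⟩) he'
    convert h2 using 1
    simp only [union_assoc]

lemma Spans.exists_list (hl : 2 * l < k) {A B X : Finset V} (h : Spans k l E A B X) :
    ∃ (w : List V) (m : ℕ), w.Nodup ∧ w.toFinset = X ∧ w.length = m * (k - l) + l ∧
      (w.take l).toFinset = A ∧ (w.drop (m * (k - l))).toFinset = B ∧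
      ∀ i < m, ((w.drop (i * (k - l))).take k).toFinset ∈ E := by
  induction h with
  | base A hA =>
    refine ⟨A.toList, 0, A.nodup_toList, by simp, by simpa using hA, ?_, by simp, by simp⟩
    rw [List.take_of_length_le (by simp [hA])]; simp
  | @step A₀ B₀ X₀ A' Z' h hA' hZ' hd hX he' ih =>
    obtain ⟨w, m, hw, hwX, hlen, htake, hdrop, hedge⟩ := ih
    have hp : (A'.toList ++ Z'.toList).length = k - l := by simp [hA', hZ']; omega
    refine ⟨A'.toList ++ Z'.toList ++ w, m + 1, ?_, ?_, ?_, ?_, ?_, ?_⟩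
    · rw [List.nodup_append', List.nodup_append']
      refine ⟨⟨A'.nodup_toList, Z'.nodup_toList, ?_⟩, hw, ?_⟩
      · intro x ha hb
        exact disjoint_left.1 hd (mem_toList.1 ha) (mem_toList.1 hb)
      · intro x ha hb
        refine (disjoint_left.1 hX : ∀ ⦃a⦄, _ → a ∉ _) (by simpa using ha : x ∈ _) ?_
        rw [← hwX]; simpa using hb
    · simp [List.toFinset_append, hwX]
    · rw [List.length_append, hp, hlen]; ring
    · rw [List.append_assoc, List.take_append_of_le_length (by simp [hA']),
        List.take_of_length_le (by simp [hA'])]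
      simp
    · rw [List.drop_append, hp, List.drop_of_length_le (by rw [hp, add_mul]; omega)]
      rw [List.nil_append, ← hdrop]
      congr 2
      rw [add_mul]; omega
    · intro i hi
      rcases i with _ | i
      · rw [zero_mul, List.drop_zero, List.take_append, hp,
          List.take_of_length_le (by rw [hp]; omega)]
        have : k - (k - l) = l := by omega
        rw [this, List.toFinset_append, htake, List.toFinset_append]
        simpa using he'
      · rw [List.drop_append, hp, List.drop_of_length_le (by rw [hp, add_mul]; omega),
          List.nil_append]
        have : (i + 1) * (k - l) - (k - l) = i * (k - l) := by rw [add_mul]; omega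
        rw [this]
        exact hedge i (by omega)

end Spans

lemma Spans.hasHamCycle {n k l : ℕ} (hl : 2 * l < k) {E : Finset (Finset (Fin n))}
    {A B X Z : Finset (Fin n)} (h : Spans k l E A B X) (hZ : Z.card = k - 2 * l)
    (hXl : l < X.card) (hXZ : Disjoint X Z)
    (hu : X ∪ Z = univ) (he : B ∪ Z ∪ A ∈ E) :
    HasHamCycle k l E := by
  obtain ⟨w, m, hw, hwX, hlen, htake, hdrop, hedge⟩ := h.exists_list hl
  have hkl : 0 < k - l := by omega
  have hm : 0 < m := by
    rw [← hwX, List.toFinset_card_of_nodup hw, hlen] at hXl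
    rcases Nat.eq_zero_or_pos m with rfl | h
    · simp at hXl
    · exact h
  have hlen' : (w ++ Z.toList).length = (m + 1) * (k - l) := by
    rw [List.length_append, hlen, length_toList, hZ, add_mul]; omega
  have hdiv : (w ++ Z.toList).length / (k - l) = m + 1 := by
    rw [hlen', Nat.mul_div_cancel _ hkl]
  refine ⟨w ++ Z.toList, ?_, ?_, ?_, ?_⟩
  · rw [List.nodup_append']
    refine ⟨hw, Z.nodup_toList, fun a ha hb => ?_⟩
    refine (disjoint_left.1 hXZ : ∀ ⦃a⦄, _ → a ∉ _) (?_ : a ∈ _) (mem_toList.1 hb)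
    rw [← hwX]; simpa using ha
  · intro v
    have : v ∈ X ∪ Z := by rw [hu]; exact mem_univ v
    rw [← hwX] at this
    simpa using this
  · rw [hdiv]; omega
  · intro i hi
    rw [hdiv] at hi
    have him : i * (k - l) ≤ m * (k - l) := Nat.mul_le_mul_right _ (by omega)
    rw [List.rotate_eq_drop_append_take (by rw [hlen', add_mul]; omega)]
    rcases Nat.lt_succ_iff_lt_or_eq.1 hi with hi | rfl
    · have him' : (i + 1) * (k - l) ≤ m * (k - l) := Nat.mul_le_mul_right _ (by omega)
      rw [add_mul] at him'
      rw [List.drop_append_of_le_length (by omega), List.append_assoc,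
        List.take_append_of_le_length (by rw [List.length_drop]; omega)]
      exact hedge i hi
    · rw [List.drop_append_of_le_length (by omega), List.take_append,
        List.take_of_length_le (by
          simp only [List.length_append, List.length_drop, length_toList]; omega), List.take_take]
      have h1 : k - (List.drop (i * (k - l)) w ++ Z.toList).length = l := by
        simp only [List.length_append, List.length_drop, length_toList]; omega
      have h2 : k - l ≤ i * (k - l) := Nat.le_mul_of_pos_left _ hm
      rw [h1, min_eq_left (by omega), List.take_append_of_le_length (by omega),
        List.toFinset_append, List.toFinset_append, htake, hdrop]
      simpa using he

/-- The vertices completing `S` to an edge of `E`. -/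
def linkVerts {V : Type*} [Fintype V] [DecidableEq V] (E : Finset (Finset V)) (S : Finset V) :
    Finset V :=
  univ.filter fun v => v ∉ S ∧ insert v S ∈ E

lemma mem_linkVerts {V : Type*} [Fintype V] [DecidableEq V] {E : Finset (Finset V)}
    {S : Finset V} {v : V} : v ∈ linkVerts E S ↔ v ∉ S ∧ insert v S ∈ E := by
  simp [linkVerts]

/-- Greedy choice of `r` vertices, with at least `d` options at every step, always
produces a set satisfying `Q`. -/
def Many {V : Type*} [DecidableEq V] (d : ℕ) : ℕ → (Finset V → Prop) → Prop
  | 0, Q => Q ∅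
  | r + 1, Q => ∃ T : Finset V, d ≤ T.card ∧ ∀ v ∈ T, Many d r fun X => Q (insert v X)

section Many
variable {V : Type*} [DecidableEq V] {d : ℕ}

lemma Many.mono {r : ℕ} {Q Q' : Finset V → Prop} (h : Many d r Q) (hQ : ∀ X, Q X → Q' X) :
    Many d r Q' := by
  induction r generalizing Q Q' with
  | zero => exact hQ _ h
  | succ r ih =>
    obtain ⟨T, hT, h⟩ := h
    exact ⟨T, hT, fun v hv => ih (h v hv) fun X => hQ _⟩

lemma Many.bind {r s : ℕ} {P Q : Finset V → Prop} (h : Many d r P)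
    (h' : ∀ X, P X → Many d s fun Y => Q (X ∪ Y)) : Many d (r + s) Q := by
  induction r generalizing P Q with
  | zero => simpa using h' _ h
  | succ r ih =>
    obtain ⟨T, hT, h⟩ := h
    rw [Nat.add_right_comm]
    refine ⟨T, hT, fun v hv => ih (h v hv) fun X hX => ?_⟩
    simpa [insert_union] using h' _ hX

lemma Many.and_card_le {r : ℕ} {Q : Finset V → Prop} (h : Many d r Q) :
    Many d r fun X => Q X ∧ X.card ≤ r := by
  induction r generalizing Q with
  | zero => exact ⟨h, by simp⟩
  | succ r ih =>
    obtain ⟨T, hT, h⟩ := h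
    exact ⟨T, hT, fun v hv => (ih (h v hv)).mono fun X hX =>
      ⟨hX.1, (card_insert_le _ _).trans (by omega)⟩⟩

open Classical in
lemma Many.card_le [Fintype V] {r : ℕ} {Q : Finset V → Prop} (h : Many d r Q) :
    d ^ r ≤ (univ.filter fun w : Fin r → V => Q (univ.image w)).card := by
  induction r generalizing Q with
  | zero =>
    have h' : Q ∅ := h
    simp [filter_true_of_mem, h']
  | succ r ih =>
    obtain ⟨T, hT, h⟩ := h
    calc d ^ (r + 1) = ∑ _ ∈ range d, d ^ r := by simp [pow_succ, mul_comm]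
      _ ≤ ∑ v ∈ T, (univ.filter fun w : Fin r → V => Q (insert v (univ.image w))).card := by
        rw [sum_const, card_range, smul_eq_mul]
        exact (Nat.mul_le_mul_right _ hT).trans (card_nsmul_le_sum _ _ _ fun v hv => ih (h v hv))
      _ = (T.sigma fun v => univ.filter fun w : Fin r → V => Q (insert v (univ.image w))).card :=
        (card_sigma _ _).symm
      _ ≤ _ := by
        refine card_le_card_of_injOn (fun p => Fin.cons p.1 p.2) ?_ ?_
        · rintro ⟨v, w⟩ hp
          simp only [coe_sigma, Set.mem_sigma_iff, coe_filter, mem_univ, true_and,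
            Set.mem_ofPred_eq] at hp ⊢
          convert hp.2
          ext x
          simp [Fin.exists_fin_succ, eq_comm]
        · rintro ⟨v, w⟩ - ⟨v', w'⟩ - hp
          obtain ⟨rfl, rfl⟩ := Fin.cons_injective2 hp
          rfl

variable [Fintype V]

lemma many_free {n : ℕ} (hn : n ≤ Fintype.card V) (t : ℕ) (F : Finset V)
    (hF : d + F.card + t ≤ n) : Many d t fun Z => Z.card = t ∧ Disjoint Z F := by
  induction t generalizing F with
  | zero => exact ⟨by simp, by simp⟩
  | succ t ih =>
    refine ⟨Fᶜ, by rw [card_compl]; omega, fun v hv => ?_⟩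
    have hvF : v ∉ F := by simpa using hv
    refine (ih (insert v F) (by rw [card_insert_of_notMem hvF]; omega)).mono ?_
    rintro X ⟨hX, hXF⟩
    rw [disjoint_insert_right] at hXF
    refine ⟨by rw [card_insert_of_notMem hXF.1, hX], ?_⟩
    rw [disjoint_insert_left]
    exact ⟨hvF, hXF.2⟩

lemma many_extend {k D : ℕ} {E : Finset (Finset V)} (hD : D ≤ Fintype.card V)
    (hdeg : ∀ S : Finset V, S.card = k - 1 → D ≤ (linkVerts E S).card)
    (t : ℕ) (S F : Finset V) (hS : S.card + t = k) (ht : 0 < t) (hF : d + F.card + k ≤ D) :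
    Many d t fun Z => Z.card = t ∧ Disjoint Z (S ∪ F) ∧ S ∪ Z ∈ E := by
  induction t generalizing S with
  | zero => omega
  | succ t ih =>
    rcases Nat.eq_zero_or_pos t with rfl | ht'
    · refine ⟨linkVerts E S \ F, ?_, fun v hv => ?_⟩
      · have := le_card_sdiff F (linkVerts E S)
        have := hdeg S (by omega)
        omega
      · simp only [mem_sdiff, mem_linkVerts] at hv
        refine ⟨by simp, ?_, ?_⟩
        · simp [hv.1.1, hv.2]
        · simpa [union_insert] using hv.1.2
    · refine ⟨(S ∪ F)ᶜ, ?_, fun v hv => ?_⟩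
      · have := card_union_le S F
        rw [card_compl]; omega
      · simp only [mem_compl, mem_union, not_or] at hv
        refine (ih (insert v S) (by rw [card_insert_of_notMem hv.1]; omega) ht').mono ?_
        rintro X ⟨hX, hXF, hE⟩
        rw [insert_union, disjoint_insert_right] at hXF
        refine ⟨by rw [card_insert_of_notMem hXF.1, hX], ?_, ?_⟩
        · rw [disjoint_insert_left]
          simp [hv.1, hv.2, hXF.2]
        · simpa [insert_union, union_insert] using hE

end Many

lemma exists_union_of_card_add {V : Type*} [DecidableEq V] {X : Finset V} {a b : ℕ}
    (h : X.card = a + b) :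
    ∃ Y Z : Finset V, Y.card = a ∧ Z.card = b ∧ Disjoint Y Z ∧ X = Y ∪ Z := by
  obtain ⟨Y, hY, hc⟩ := exists_subset_card_eq (s := X) (n := a) (by omega)
  exact ⟨Y, X \ Y, hc, by rw [card_sdiff_of_subset hY]; omega, disjoint_sdiff,
    (union_sdiff_of_subset hY).symm⟩

section Absorb
variable {V : Type*} [Fintype V] [DecidableEq V] {d k l D : ℕ} {E : Finset (Finset V)}

lemma spans_two_edges {A Z C Z' B : Finset V} (hA : A.card = l) (hZ : Z.card = k - 2 * l)
    (hC : C.card = l) (hZ' : Z'.card = k - 2 * l) (hB : B.card = l)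
    (h1 : Disjoint A (Z ∪ C ∪ Z' ∪ B)) (h2 : Disjoint Z (C ∪ Z' ∪ B)) (h3 : Disjoint C (Z' ∪ B))
    (h4 : Disjoint Z' B) (e1 : A ∪ Z ∪ C ∈ E) (e2 : C ∪ Z' ∪ B ∈ E) :
    Spans k l E A B (A ∪ Z ∪ (C ∪ Z' ∪ B)) := by
  simp only [disjoint_union_right] at h1 h2 h3
  refine .step (.step (.base B hB) hC hZ' h3.1 ?_ e2) hA hZ h1.1.1.1 ?_ e1
  · rw [disjoint_union_left]; exact ⟨h3.2, h4⟩
  · simp only [disjoint_union_left, disjoint_union_right]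
    tauto

/-- Two vertices `x` and `y` can be exchanged inside `l`-paths on `X ∪ {x}` and `X ∪ {y}` having
the same ends. -/
lemma many_swap (hl1 : 1 ≤ l) (hl : 2 * l < k) (hD : D ≤ Fintype.card V)
    (hdeg : ∀ S : Finset V, S.card = k - 1 → D ≤ (linkVerts E S).card)
    (x y : V) (F : Finset V) (hF : d + F.card + 3 * k ≤ D) :
    Many d ((k - 2) + (1 + (1 + (k - l - 1)))) fun X =>
      Disjoint X (insert x (insert y F)) ∧ ∃ A B, A ⊆ X ∧ B ⊆ X ∧
        Spans k l E A B (insert x X) ∧ Spans k l E A B (insert y X) := by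
  have hF2 : (insert x (insert y F)).card ≤ F.card + 2 :=
    (card_insert_le _ _).trans (by have := card_insert_le y F; omega)
  refine (many_free hD (k - 2) (insert x (insert y F)) (by omega)).bind ?_
  rintro W ⟨hW, hWF⟩
  have hxW : x ∉ W := fun h => disjoint_left.1 hWF h (by simp)
  have hyW : y ∉ W := fun h => disjoint_left.1 hWF h (by simp)
  refine (many_extend hD hdeg 1 (insert x W) (insert y F)
    (by rw [card_insert_of_notMem hxW]; omega) one_pos (by
      have := card_insert_le y F; omega)).bind ?_
  rintro X1 ⟨h1, h1d, h1E⟩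
  obtain ⟨x1, rfl⟩ := card_eq_one.1 h1
  refine (many_extend hD hdeg 1 (insert y W) (insert x (insert x1 F))
    (by rw [card_insert_of_notMem hyW]; omega) one_pos (by
      have := card_insert_le x (insert x1 F); have := card_insert_le x1 F; omega)).bind ?_
  rintro X2 ⟨h2, h2d, h2E⟩
  obtain ⟨x2, rfl⟩ := card_eq_one.1 h2
  obtain ⟨A, W', hA, hW', hAW', rfl⟩ :=
    exists_union_of_card_add (X := W) (a := l) (b := (k - 2 * l - 1) + (l - 1)) (by omega)
  obtain ⟨Z, O, hZ, hO, hZO, rfl⟩ := exists_union_of_card_add hW'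
  rw [disjoint_singleton_left] at h1d h2d
  have hx12 : x1 ≠ x2 := by rintro rfl; simp at h2d
  refine (many_extend hD hdeg (k - l - 1) (insert x1 (insert x2 O)) (A ∪ Z ∪ insert x (insert y F))
    (by
      rw [card_insert_of_notMem (by grind), card_insert_of_notMem (by grind)]
      omega) (by omega) (by
      have := card_union_le (A ∪ Z) (insert x (insert y F))
      have := card_union_le A Z
      omega)).mono ?_
  rintro Y ⟨hY, hYd, hYE⟩
  obtain ⟨B, Z', hB, hZ', hBZ', rfl⟩ :=
    exists_union_of_card_add (X := Y) (a := l) (b := (k - 2 * l - 1)) (by omega)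
  simp only [disjoint_union_left, disjoint_union_right, disjoint_insert_left,
    disjoint_insert_right, mem_union, mem_insert, mem_singleton, not_or] at hWF hYd hBZ' hAW' h1d h2d hxW hyW
  clear hdeg hF hF2 hD hY hW hW' h1 h2
  refine ⟨?_, A, B, fun z hz => by simp [hz], fun z hz => by simp [hz], ?_, ?_⟩
  · simp only [disjoint_union_left, disjoint_union_right, disjoint_insert_left,
    disjoint_insert_right, mem_union, mem_insert, mem_singleton, not_or, disjoint_singleton_left]
    grind only [→ Disjoint.symm]
  · have := spans_two_edges (E := E) (k := k) (Z := insert x Z) (C := insert x1 O)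
      (Z' := insert x2 Z') hA
      (by rw [card_insert_of_notMem (by grind)]; omega)
      (by rw [card_insert_of_notMem (by grind)]; omega)
      (by rw [card_insert_of_notMem (by grind)]; omega) hB
      (by simp only [disjoint_union_left, disjoint_union_right, disjoint_insert_left,
    disjoint_insert_right, mem_union, mem_insert, mem_singleton, not_or]; grind only [→ Disjoint.symm])
      (by simp only [disjoint_union_left, disjoint_union_right, disjoint_insert_left,
    disjoint_insert_right, mem_union, mem_insert, mem_singleton, not_or]; grind only [→ Disjoint.symm])
      (by simp only [disjoint_union_left, disjoint_union_right, disjoint_insert_left,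
    disjoint_insert_right, mem_union, mem_insert, mem_singleton, not_or]; grind only [→ Disjoint.symm])
      (by simp only [disjoint_union_left, disjoint_union_right, disjoint_insert_left,
    disjoint_insert_right, mem_union, mem_insert, mem_singleton, not_or]; grind only [→ Disjoint.symm])
      (by convert h1E using 1; grind) (by convert hYE using 1; grind)
    convert this using 1
    grind
  · have := spans_two_edges (E := E) (k := k) (Z := insert y Z) (C := insert x2 O)
      (Z' := insert x1 Z') hA
      (by rw [card_insert_of_notMem (by grind)]; omega)
      (by rw [card_insert_of_notMem (by grind)]; omega)
      (by rw [card_insert_of_notMem (by grind)]; omega) hB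
      (by simp only [disjoint_union_left, disjoint_union_right, disjoint_insert_left,
    disjoint_insert_right, mem_union, mem_insert, mem_singleton, not_or]; grind only [→ Disjoint.symm])
      (by simp only [disjoint_union_left, disjoint_union_right, disjoint_insert_left,
    disjoint_insert_right, mem_union, mem_insert, mem_singleton, not_or]; grind only [→ Disjoint.symm])
      (by simp only [disjoint_union_left, disjoint_union_right, disjoint_insert_left,
    disjoint_insert_right, mem_union, mem_insert, mem_singleton, not_or]; grind only [→ Disjoint.symm])
      (by simp only [disjoint_union_left, disjoint_union_right, disjoint_insert_left,
    disjoint_insert_right, mem_union, mem_insert, mem_singleton, not_or]; grind only [→ Disjoint.symm])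
      (by convert h2E using 1; grind) (by convert hYE using 1; grind)
    convert this using 1
    grind

/-- Given disjoint `M` and `T` of the same size `j`, greedy choice produces sets `X` such that
`X ∪ M` and `X ∪ T` both span `l`-paths, with the same ends inside `X`. -/
lemma exists_many_swap (k l : ℕ) (hl1 : 1 ≤ l) (hl : 2 * l < k) (j : ℕ) :
    ∃ r C : ℕ, ∀ {V : Type*} [Fintype V] [DecidableEq V] {d D : ℕ} {E : Finset (Finset V)},
      D ≤ Fintype.card V →
      (∀ S : Finset V, S.card = k - 1 → D ≤ (linkVerts E S).card) →
      ∀ M T F : Finset V, M.card = j → T.card = j → Disjoint M T → d + F.card + C ≤ D →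
      Many d r fun X => Disjoint X (M ∪ T ∪ F) ∧ ∃ A B, A ⊆ X ∧ B ⊆ X ∧
        Spans k l E A B (X ∪ M) ∧ Spans k l E A B (X ∪ T) := by
  induction j with
  | zero =>
    refine ⟨l, l, fun {V} _ _ {d D E} hD hdeg M T F hM hT _ hF => ?_⟩
    rw [card_eq_zero] at hM hT
    subst hM hT
    refine (many_free hD l F (by omega)).mono ?_
    rintro X ⟨hX, hXF⟩
    refine ⟨by simpa using hXF, X, X, subset_rfl, subset_rfl, ?_, ?_⟩ <;>
    · rw [union_empty]
      exact .base X hX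
  | succ j ih =>
    obtain ⟨r, C, ih⟩ := ih
    set s := (k - 2) + (1 + (1 + (k - l - 1))) with hs
    refine ⟨r + (s + (k - 2 * l)), C + r + s + 2 * j + 3 * k + 4,
      fun {V} _ _ {d D E} hD hdeg M T F hM hT hMT hF => ?_⟩
    obtain ⟨x, M', hx, rfl, hM'⟩ := card_eq_succ.1 hM
    obtain ⟨y, T', hy, rfl, hT'⟩ := card_eq_succ.1 hT
    have hcF1 := card_insert_le x (insert y F)
    have hcF2 := card_insert_le y F
    refine (ih hD hdeg M' T' (insert x (insert y F)) hM' hT' (by grind)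
      (by omega)).and_card_le.bind ?_
    rintro X₁ ⟨⟨hX₁, A₁, B₁, hA₁, hB₁, hM₁, hT₁⟩, hc₁⟩
    have hcF3 : (X₁ ∪ (M' ∪ (T' ∪ F))).card ≤ r + 2 * j + F.card := by
      have h1 := card_union_le X₁ (M' ∪ (T' ∪ F))
      have h2 := card_union_le M' (T' ∪ F)
      have h3 := card_union_le T' F
      omega
    refine (many_swap hl1 hl hD hdeg x y (X₁ ∪ (M' ∪ (T' ∪ F)))
      (by omega)).and_card_le.bind ?_
    rintro X₂ ⟨⟨hX₂, A₂, B₂, hA₂, hB₂, hM₂, hT₂⟩, hc₂⟩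
    simp only [disjoint_union_left, disjoint_union_right, disjoint_insert_left,
    disjoint_insert_right, mem_union, mem_insert, mem_singleton, not_or] at hX₁ hX₂ hMT
    have hBA : Disjoint B₁ A₂ := (hX₂.2.2.1.mono hA₂ hB₁).symm
    have hcF4 : (X₁ ∪ X₂ ∪ (insert x (insert y (M' ∪ (T' ∪ F))))).card ≤
        r + s + 2 * j + 2 + F.card := by
      have h1 := card_union_le (X₁ ∪ X₂) (insert x (insert y (M' ∪ (T' ∪ F))))
      have h1 := card_union_le X₁ X₂
      have h2 := card_union_le M' (T' ∪ F)
      have h3 := card_union_le T' F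
      have h4 := card_insert_le x (insert y (M' ∪ (T' ∪ F)))
      have h5 := card_insert_le y (M' ∪ (T' ∪ F))
      omega
    refine (many_extend hD hdeg (k - 2 * l) (B₁ ∪ A₂)
      (X₁ ∪ X₂ ∪ (insert x (insert y (M' ∪ (T' ∪ F)))))
      (by rw [card_union_of_disjoint hBA, hM₁.card_right, hM₂.card_left]; omega) (by omega)
      (by omega)).mono ?_
    rintro Z ⟨hZ, hZd, hZE⟩
    rw [union_right_comm] at hZE
    simp only [disjoint_union_left, disjoint_union_right, disjoint_insert_left,
    disjoint_insert_right, mem_union, mem_insert, mem_singleton, not_or] at hZd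
    clear hcF4 hcF3 hcF2 hcF1 hc₁ hc₂ hF hdeg ih hM hT hM' hT' hD hs
    refine ⟨(by simp only [disjoint_union_left, disjoint_union_right, disjoint_insert_left,
    disjoint_insert_right, mem_union, mem_insert, mem_singleton, not_or]; grind only [→ Disjoint.symm]), A₁, B₂, by grind, by grind, ?_, ?_⟩
    · convert hM₁.join hM₂ hZ (by simp only [disjoint_union_left, disjoint_union_right, disjoint_insert_left,
    disjoint_insert_right, mem_union, mem_insert, mem_singleton, not_or]; grind only [→ Disjoint.symm])
        (by simp only [disjoint_union_left, disjoint_union_right, disjoint_insert_left,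
    disjoint_insert_right, mem_union, mem_insert, mem_singleton, not_or]; grind only [→ Disjoint.symm])
        (by simp only [disjoint_union_left, disjoint_union_right, disjoint_insert_left,
    disjoint_insert_right, mem_union, mem_insert, mem_singleton, not_or]; grind only [→ Disjoint.symm]) hZE using 1
      grind
    · convert hT₁.join hT₂ hZ (by simp only [disjoint_union_left, disjoint_union_right, disjoint_insert_left,
    disjoint_insert_right, mem_union, mem_insert, mem_singleton, not_or]; grind only [→ Disjoint.symm])
        (by simp only [disjoint_union_left, disjoint_union_right, disjoint_insert_left,
    disjoint_insert_right, mem_union, mem_insert, mem_singleton, not_or]; grind only [→ Disjoint.symm])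
        (by simp only [disjoint_union_left, disjoint_union_right, disjoint_insert_left,
    disjoint_insert_right, mem_union, mem_insert, mem_singleton, not_or]; grind only [→ Disjoint.symm]) hZE using 1
      grind

/-- Every set `T` of `k - l` vertices can be absorbed by greedily chosen sets `X`. -/
lemma exists_many_absorb (k l : ℕ) (hl1 : 1 ≤ l) (hl : 2 * l < k) :
    ∃ r C : ℕ, ∀ {V : Type*} [Fintype V] [DecidableEq V] {d D : ℕ} {E : Finset (Finset V)},
      D ≤ Fintype.card V →
      (∀ S : Finset V, S.card = k - 1 → D ≤ (linkVerts E S).card) →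
      ∀ T F : Finset V, T.card = k - l → d + F.card + C ≤ D →
      Many d r fun X => Disjoint X (T ∪ F) ∧ ∃ A B, A ⊆ X ∧ B ⊆ X ∧ Disjoint A B ∧
        Spans k l E A B X ∧ Spans k l E A B (X ∪ T) := by
  obtain ⟨r, C, hr⟩ := exists_many_swap k l hl1 hl (k - l)
  refine ⟨(k - l) + (l + (l + ((k - 2 * l) + (r + (k - 2 * l))))), C + r + 5 * k,
    fun {V} _ _ {d D E} hD hdeg T F hT hF => ?_⟩
  have hTF := card_union_le T F
  refine (many_free hD (k - l) (T ∪ F) (by omega)).bind ?_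
  rintro P ⟨hP, hPd⟩
  refine (many_extend hD hdeg l P (T ∪ F) (by omega) (by omega) (by omega)).bind ?_
  rintro B ⟨hB, hBd, hBE⟩
  have hBTF := card_union_le B (T ∪ F)
  simp only [disjoint_union_left, disjoint_union_right, disjoint_insert_left,
    disjoint_insert_right, mem_union, mem_insert, mem_singleton, not_or] at hPd hBd
  refine (many_extend hD hdeg l P (B ∪ (T ∪ F)) (by omega) (by omega) (by omega)).bind ?_
  rintro C₁ ⟨hC, hCd, hCE⟩
  simp only [disjoint_union_left, disjoint_union_right, disjoint_insert_left,
    disjoint_insert_right, mem_union, mem_insert, mem_singleton, not_or] at hCd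
  have hPTF := card_union_le P (T ∪ F)
  refine (many_extend hD hdeg (k - 2 * l) (C₁ ∪ B) (P ∪ (T ∪ F))
    (by rw [card_union_of_disjoint hCd.2.1]; omega) (by omega) (by omega)).bind ?_
  rintro Y ⟨hY, hYd, hYE⟩
  simp only [disjoint_union_left, disjoint_union_right, disjoint_insert_left,
    disjoint_insert_right, mem_union, mem_insert, mem_singleton, not_or] at hYd
  have hPBF := card_union_le (P ∪ B) F
  have hPB := card_union_le P B
  refine (hr hD hdeg (C₁ ∪ Y) T (P ∪ B ∪ F)
    (by rw [card_union_of_disjoint hYd.1.1.symm]; omega) hT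
      (disjoint_union_left.2 ⟨hCd.2.2.1, hYd.2.2.1⟩)
    (by omega)).and_card_le.bind ?_
  rintro X ⟨⟨hX, A', B', hA', hB', hM, hTX⟩, hcX⟩
  simp only [disjoint_union_left, disjoint_union_right, disjoint_insert_left,
    disjoint_insert_right, mem_union, mem_insert, mem_singleton, not_or] at hX
  have hBA : Disjoint B A' := (hX.2.1.2.mono_left hA').symm
  have h1 := card_union_le (P ∪ C₁ ∪ Y ∪ X) (T ∪ F)
  have h2 := card_union_le (P ∪ C₁ ∪ Y) X
  have h3 := card_union_le (P ∪ C₁) Y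
  have h4 := card_union_le P C₁
  refine (many_extend hD hdeg (k - 2 * l) (B ∪ A') (P ∪ C₁ ∪ Y ∪ X ∪ (T ∪ F))
    (by rw [card_union_of_disjoint hBA, hM.card_left]; omega) (by omega) (by omega)).mono ?_
  rintro Z' ⟨hZ', hZd', hZE'⟩
  obtain ⟨A, Z, hA, hZ, hAZ, rfl⟩ :=
    exists_union_of_card_add (X := P) (a := l) (b := k - 2 * l) (by omega)
  rw [union_right_comm] at hZE' hYE
  simp only [disjoint_union_left, disjoint_union_right, disjoint_insert_left,
    disjoint_insert_right, mem_union, mem_insert, mem_singleton, not_or] at hZd' hYd hCd hBd hPd hX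
  clear hdeg hr h1 h2 h3 h4 hPB hPBF hPTF hBTF hTF hcX hP hF hD
  have hB'X := hX.2.1.1.1.mono_left hB'
  refine ⟨(by simp only [disjoint_union_left, disjoint_union_right, disjoint_insert_left,
    disjoint_insert_right, mem_union, mem_insert, mem_singleton, not_or]; grind only [→ Disjoint.symm]), A, B', by grind, by grind, (by grind only [→ Disjoint.symm]), ?_, ?_⟩
  · have h := Spans.step (.base B hB) hA hZ hAZ (by simp only [disjoint_union_left, disjoint_union_right, disjoint_insert_left,
    disjoint_insert_right, mem_union, mem_insert, mem_singleton, not_or]; grind only [→ Disjoint.symm]) hBE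
    convert h.join hM hZ' (by simp only [disjoint_union_left, disjoint_union_right, disjoint_insert_left,
    disjoint_insert_right, mem_union, mem_insert, mem_singleton, not_or]; grind only [→ Disjoint.symm])
      (by simp only [disjoint_union_left, disjoint_union_right, disjoint_insert_left,
    disjoint_insert_right, mem_union, mem_insert, mem_singleton, not_or]; grind only [→ Disjoint.symm])
      (by simp only [disjoint_union_left, disjoint_union_right, disjoint_insert_left,
    disjoint_insert_right, mem_union, mem_insert, mem_singleton, not_or]; grind only [→ Disjoint.symm]) hZE' using 1
    grind
  · have h := spans_two_edges hA hZ hC hY hB (by simp only [disjoint_union_left, disjoint_union_right, disjoint_insert_left,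
    disjoint_insert_right, mem_union, mem_insert, mem_singleton, not_or]; grind only [→ Disjoint.symm])
      (by simp only [disjoint_union_left, disjoint_union_right, disjoint_insert_left,
    disjoint_insert_right, mem_union, mem_insert, mem_singleton, not_or]; grind only [→ Disjoint.symm])
      (by simp only [disjoint_union_left, disjoint_union_right, disjoint_insert_left,
    disjoint_insert_right, mem_union, mem_insert, mem_singleton, not_or]; grind only [→ Disjoint.symm])
      (by grind only [→ Disjoint.symm]) hCE hYE
    convert h.join hTX hZ' (by simp only [disjoint_union_left, disjoint_union_right, disjoint_insert_left,
    disjoint_insert_right, mem_union, mem_insert, mem_singleton, not_or]; grind only [→ Disjoint.symm])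
      (by simp only [disjoint_union_left, disjoint_union_right, disjoint_insert_left,
    disjoint_insert_right, mem_union, mem_insert, mem_singleton, not_or]; grind only [→ Disjoint.symm])
      (by simp only [disjoint_union_left, disjoint_union_right, disjoint_insert_left,
    disjoint_insert_right, mem_union, mem_insert, mem_singleton, not_or]; grind only [→ Disjoint.symm]) hZE' using 1
    grind

end Absorb

section Link
variable {V : Type*} [Fintype V] [DecidableEq V] {k l D : ℕ} {E : Finset (Finset V)}

lemma exists_extend_within {W : Finset V} (hW : D ≤ W.card)
    (hdeg : ∀ S : Finset V, S.card = k - 1 → D ≤ (linkVerts E S ∩ W).card)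
    (t : ℕ) (S F : Finset V) (hS : S.card + t = k) (ht : 0 < t) (hF : (F ∩ W).card + k ≤ D) :
    ∃ Z : Finset V, Z.card = t ∧ Z ⊆ W ∧ Disjoint Z (S ∪ F) ∧ S ∪ Z ∈ E := by
  induction t generalizing S with
  | zero => omega
  | succ t ih =>
    rcases Nat.eq_zero_or_pos t with rfl | ht'
    · have hd := hdeg S (by omega)
      have : ((linkVerts E S ∩ W) \ (F ∩ W)).Nonempty := by
        rw [← card_pos]
        have := le_card_sdiff (F ∩ W) (linkVerts E S ∩ W)
        omega
      obtain ⟨v, hv⟩ := this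
      simp only [mem_sdiff, mem_inter, mem_linkVerts] at hv
      refine ⟨{v}, by simp, by simpa using hv.1.2, ?_, ?_⟩
      · simp only [disjoint_singleton_left, mem_union]
        tauto
      · simpa [union_insert] using hv.1.1.2
    · have : (W \ (S ∪ F ∩ W)).Nonempty := by
        rw [← card_pos]
        have := le_card_sdiff (S ∪ F ∩ W) W
        have := card_union_le S (F ∩ W)
        omega
      obtain ⟨v, hv⟩ := this
      simp only [mem_sdiff, mem_union, mem_inter, not_or] at hv
      obtain ⟨X, hX, hXW, hXF, hE⟩ :=
        ih (insert v S) (by rw [card_insert_of_notMem hv.2.1]; omega) ht'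
      rw [insert_union, disjoint_insert_right] at hXF
      refine ⟨insert v X, by rw [card_insert_of_notMem hXF.1, hX],
        insert_subset hv.1 hXW, ?_, ?_⟩
      · rw [disjoint_insert_left, mem_union]
        exact ⟨by tauto, hXF.2⟩
      · simpa [insert_union, union_insert] using hE

lemma exists_link {ι : Type*} [DecidableEq ι] (hl : 2 * l < k) {W : Finset V} (hW : D ≤ W.card)
    (hdeg : ∀ S : Finset V, S.card = k - 1 → D ≤ (linkVerts E S ∩ W).card)
    (a b : ι → Finset V) (F : Finset V) {s : Finset ι} (hs : s.Nonempty)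
    (ha : ∀ i ∈ s, (a i).card = l) (hb : ∀ i ∈ s, (b i).card = l)
    (hab : ∀ i ∈ s, ∀ j ∈ s, i ≠ j → Disjoint (b i) (a j))
    (hF : (F ∩ W).card + k * s.card ≤ D) :
    ∃ i₀ ∈ s, ∃ i₁ ∈ s, ∃ K ⊆ W, Disjoint K F ∧ K.card + k ≤ k * s.card ∧
      ∀ Y : ι → Finset V, (∀ i ∈ s, Spans k l E (a i) (b i) (Y i)) →
        (s : Set ι).PairwiseDisjoint Y → (∀ i ∈ s, Disjoint (Y i) K) →
        Spans k l E (a i₀) (b i₁) (K ∪ s.biUnion Y) := by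
  induction hs using Finset.Nonempty.cons_induction with
  | singleton i =>
    refine ⟨i, by simp, i, by simp, ∅, by simp, by simp, by simp, fun Y hY _ _ => ?_⟩
    simpa using hY i
  | cons i s hi hs ih =>
    rw [card_cons, mul_add, mul_one] at hF
    simp only [mem_cons, forall_eq_or_imp] at ha hb hab
    obtain ⟨i₀, h₀, i₁, h₁, K, hKW, hKF, hK, h⟩ :=
      ih ha.2 hb.2 (fun i hi j hj => (hab.2 i hi).2 j hj) (by omega)
    have hne : i ≠ i₀ := by rintro rfl; exact hi h₀
    obtain ⟨Z, hZ, hZW, hZF, hE⟩ := exists_extend_within hW hdeg (k - 2 * l) (b i ∪ a i₀) (K ∪ F)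
      (by rw [card_union_of_disjoint (hab.1.2 i₀ h₀ hne), hb.1, ha.2 i₀ h₀]; omega) (by omega)
      (by
        have := card_le_card (union_inter_distrib_right K F W).subset
        have := card_union_le (K ∩ W) (F ∩ W)
        have := card_le_card (inter_subset_left : K ∩ W ⊆ K)
        omega)
    rw [disjoint_union_right, disjoint_union_right, disjoint_union_right] at hZF
    refine ⟨i, by simp, i₁, by simp [h₁], Z ∪ K, union_subset hZW hKW,
      disjoint_union_left.2 ⟨hZF.2.2, hKF⟩, ?_, fun Y hY hYd hYK => ?_⟩
    · have := card_union_le Z K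
      rw [card_cons, mul_add, mul_one]
      omega
    · simp only [mem_cons, forall_eq_or_imp, disjoint_union_right] at hY hYK
      rw [coe_cons, Set.pairwiseDisjoint_insert_of_notMem (by simpa using hi)] at hYd
      rw [union_right_comm] at hE
      have := hY.1.join (h Y hY.2 hYd.1 fun i hi => (hYK.2 i hi).2) hZ hYK.1.1 (by
        rw [disjoint_union_right, disjoint_biUnion_right]
        exact ⟨hYK.1.2, hYd.2⟩) (by
        rw [disjoint_union_right, disjoint_biUnion_right]
        exact ⟨hZF.2.1, fun j hj => (hYK.2 j hj).1.symm⟩) hE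
      convert this using 1
      rw [cons_eq_insert, biUnion_insert]
      ac_rfl

end Link

section Selection
variable {V Ω τ : Type*} [DecidableEq V] [Fintype Ω] [Nonempty Ω]

open Classical in
lemma exists_selection_potential (Ts : Finset τ) (good : Ω → τ → Prop) (supp : Ω → Finset V)
    {r c m : ℕ} {ρ : ℝ} (hρ : 0 < ρ) (hρ1 : ρ ≤ 1) (F₀ : Finset V) (hr : ∀ x, (supp x).card ≤ r)
    (hne : ∀ x T, good x T → (supp x).Nonempty) (hTs : Ts.Nonempty)
    (hgood : ∀ F : Finset V, F.card ≤ c → ∀ T ∈ Ts, ρ * Fintype.card Ω ≤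
      ((univ.filter fun x => good x T ∧ Disjoint (supp x) F).card : ℝ)) (hc : F₀.card + r * m ≤ c) :
    ∃ ℱ : Finset Ω, ℱ.card ≤ m ∧ (ℱ : Set Ω).PairwiseDisjoint supp ∧
      (∀ x ∈ ℱ, Disjoint (supp x) F₀ ∧ ∃ T ∈ Ts, good x T) ∧
      ∑ T ∈ Ts, (1 / 2 : ℝ) ^ (ℱ.filter fun x => good x T).card ≤ (1 - ρ / 2) ^ m * Ts.card := by
  induction m with
  | zero => exact ⟨∅, by simp⟩
  | succ m ih =>
    obtain ⟨ℱ, hcard, hdisj, hℱ, hΦ⟩ := ih (by rw [mul_add] at hc; omega)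
    set w : τ → ℝ := fun T => (1 / 2 : ℝ) ^ (ℱ.filter fun x => good x T).card with hw
    have hwpos : ∀ T, 0 < w T := fun T => by positivity
    set F := F₀ ∪ ℱ.biUnion supp with hF
    have hFc : F.card ≤ c := by
      have h1 := card_union_le F₀ (ℱ.biUnion supp)
      have h2 := card_biUnion_le_card_mul ℱ supp r fun x _ => hr x
      have h3 : ℱ.card * r ≤ r * (m + 1) := by rw [mul_comm]; gcongr; omega
      rw [← hF] at h1
      omega
    set W := ∑ T ∈ Ts, w T with hW
    have hWpos : 0 < W := sum_pos (fun T _ => hwpos T) hTs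
    set P : Ω → τ → Prop := fun x T => good x T ∧ Disjoint (supp x) F with hP
    have hex : ∃ x : Ω, ρ * W ≤ ∑ T ∈ Ts with P x T, w T := by
      by_contra! hlt
      have h1 : ∑ x : Ω, ∑ T ∈ Ts with P x T, w T < ∑ x : Ω, ρ * W :=
        sum_lt_sum_of_nonempty univ_nonempty fun x _ => hlt x
      have h2 : ∑ x : Ω, ∑ T ∈ Ts with P x T, w T
          = ∑ T ∈ Ts, ((univ.filter fun x => P x T).card : ℝ) * w T := by
        simp_rw [sum_filter]
        rw [sum_comm]
        refine sum_congr rfl fun T _ => ?_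
        rw [← sum_filter, sum_const, nsmul_eq_mul]
      have h3 : ∑ T ∈ Ts, (ρ * Fintype.card Ω) * w T ≤
          ∑ T ∈ Ts, ((univ.filter fun x => P x T).card : ℝ) * w T :=
        sum_le_sum fun T hT => mul_le_mul_of_nonneg_right (hgood F hFc T hT) (hwpos T).le
      rw [← mul_sum, ← hW] at h3
      rw [sum_const, card_univ, nsmul_eq_mul, h2] at h1
      nlinarith
    obtain ⟨x, hx⟩ := hex
    have hx0 : (Ts.filter (P x)).Nonempty := by
      by_contra hne
      rw [not_nonempty_iff_eq_empty] at hne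
      rw [hne, sum_empty] at hx
      nlinarith [mul_pos hρ hWpos]
    obtain ⟨T₀, hT₀⟩ := hx0
    rw [mem_filter] at hT₀
    obtain ⟨hT₀, hgx, hxF⟩ := hT₀
    rw [hF, disjoint_union_right, disjoint_biUnion_right] at hxF
    have hxℱ : x ∉ ℱ := fun h => by
      have := hxF.2 x h
      rw [disjoint_self] at this
      exact (hne x T₀ hgx).ne_empty this
    refine ⟨insert x ℱ, by rw [card_insert_of_notMem hxℱ]; omega, ?_, ?_, ?_⟩
    · rw [coe_insert, Set.pairwiseDisjoint_insert_of_notMem (by simpa using hxℱ)]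
      exact ⟨hdisj, hxF.2⟩
    · intro y hy
      rcases mem_insert.1 hy with rfl | hy
      · exact ⟨hxF.1, T₀, hT₀, hgx⟩
      · exact hℱ y hy
    · have hstep : ∀ T ∈ Ts, (1 / 2 : ℝ) ^ ((insert x ℱ).filter fun x => good x T).card ≤
          w T - (if P x T then w T / 2 else 0) := by
        intro T _
        rw [filter_insert]
        split_ifs with h1 h2 h2
        · rw [card_insert_of_notMem (by simp [hxℱ]), pow_succ]
          linarith
        · rw [card_insert_of_notMem (by simp [hxℱ]), pow_succ]
          have := hwpos T
          simp only [hw] at this ⊢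
          linarith
        · exact absurd h2.1 h1
        · simp [hw]
      calc _ ≤ _ := sum_le_sum hstep
        _ = W - (∑ T ∈ Ts with P x T, w T) / 2 := by
          rw [sum_sub_distrib, ← sum_filter, sum_div]
        _ ≤ (1 - ρ / 2) * W := by linarith
        _ ≤ (1 - ρ / 2) * ((1 - ρ / 2) ^ m * Ts.card) := by
          exact mul_le_mul_of_nonneg_left hΦ (by linarith)
        _ = _ := by ring

open Classical in
lemma exists_selection (Ts : Finset τ) (good : Ω → τ → Prop) (supp : Ω → Finset V)
    {r c m : ℕ} {ρ : ℝ} (hρ : 0 < ρ) (hρ1 : ρ ≤ 1) (F₀ : Finset V) (hr : ∀ x, (supp x).card ≤ r)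
    (hne : ∀ x T, good x T → (supp x).Nonempty)
    (hgood : ∀ F : Finset V, F.card ≤ c → ∀ T ∈ Ts, ρ * Fintype.card Ω ≤
      ((univ.filter fun x => good x T ∧ Disjoint (supp x) F).card : ℝ)) (hc : F₀.card + r * m ≤ c)
    (hcard : (Ts.card : ℝ) ≤ Real.exp (ρ * m / 4)) :
    ∃ ℱ : Finset Ω, ℱ.card ≤ m ∧ (ℱ : Set Ω).PairwiseDisjoint supp ∧
      (∀ x ∈ ℱ, Disjoint (supp x) F₀ ∧ ∃ T ∈ Ts, good x T) ∧
      ∀ T ∈ Ts, ρ * m / 4 ≤ ((ℱ.filter fun x => good x T).card : ℝ) := by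
  rcases Ts.eq_empty_or_nonempty with rfl | hTs
  · exact ⟨∅, by simp⟩
  obtain ⟨ℱ, h1, h2, h3, h4⟩ :=
    exists_selection_potential Ts good supp hρ hρ1 F₀ hr hne hTs hgood hc
  refine ⟨ℱ, h1, h2, h3, fun T hT => ?_⟩
  have h5 := (single_le_sum (f := fun T => (1 / 2 : ℝ) ^ (ℱ.filter fun x => good x T).card)
    (fun T _ => by positivity) hT).trans h4
  have h6 : (1 - ρ / 2) ^ m ≤ Real.exp (-(ρ * m / 2)) := by
    calc (1 - ρ / 2) ^ m ≤ Real.exp (-(ρ / 2)) ^ m :=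
          pow_le_pow_left₀ (by linarith) (Real.one_sub_le_exp_neg _) m
      _ = _ := by rw [← Real.exp_nat_mul]; ring_nf
  have h7 : (1 - ρ / 2) ^ m * Ts.card ≤ Real.exp (-(ρ * m / 4)) := by
    calc _ ≤ Real.exp (-(ρ * m / 2)) * Real.exp (ρ * m / 4) := by gcongr
      _ = _ := by rw [← Real.exp_add]; ring_nf
  have h8 : Real.exp (-((ℱ.filter fun x => good x T).card : ℝ)) ≤
      (1 / 2 : ℝ) ^ (ℱ.filter fun x => good x T).card := by
    rw [← mul_neg_one, Real.exp_nat_mul]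
    refine pow_le_pow_left₀ (Real.exp_pos _).le ?_ _
    rw [Real.exp_neg, one_div]
    exact inv_anti₀ two_pos (by linarith [Real.add_one_le_exp (1 : ℝ)])
  have h9 := Real.exp_le_exp.1 ((h8.trans h5).trans h7)
  linarith

end Selection

lemma exists_pow_le_exp (K : ℕ) {δ : ℝ} (hδ : 0 < δ) :
    ∃ N : ℕ, ∀ n : ℕ, N ≤ n → (n : ℝ) ^ K ≤ Real.exp (δ * n) := by
  have h := (isLittleO_pow_exp_pos_mul_atTop K hδ).comp_tendsto tendsto_natCast_atTop_atTop
  have h2 := h.bound one_pos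
  rw [Filter.eventually_atTop] at h2
  obtain ⟨N, hN⟩ := h2
  refine ⟨N, fun n hn => ?_⟩
  have := hN n hn
  simpa [abs_of_nonneg] using this

lemma exists_common_intersection {Ω ι : Type*} [Fintype ι] [DecidableEq ι] [DecidableEq Ω]
    (S : Finset Ω) (D : ι → Finset Ω) (hD : ∀ i, D i ⊆ S) {ε : ℝ} (hε : 0 < ε) (hε1 : ε ≤ 1) (t : ℕ)
    (hcard : ∀ i, ε * S.card ≤ (D i).card) (hG : 2 * (t : ℝ) ≤ Fintype.card ι * ε) :
    ∃ I : Finset ι, I.card = t ∧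
      ε / 2 ^ (Fintype.card ι + 1) * S.card ≤ ((S.filter fun x => ∀ i ∈ I, x ∈ D i).card : ℝ) := by
  set G := Fintype.card ι with hGdef
  have htG : t ≤ G := by
    have h : (t : ℝ) ≤ G := by nlinarith [(Nat.cast_nonneg G : (0 : ℝ) ≤ G)]
    exact_mod_cast h
  rcases Nat.eq_zero_or_pos t with rfl | ht
  · refine ⟨∅, rfl, ?_⟩
    simp only [notMem_empty, false_implies, implies_true, filter_true]
    refine mul_le_of_le_one_left (Nat.cast_nonneg _) ((div_le_one (by positivity)).2 ?_)
    exact hε1.trans (one_le_pow₀ one_le_two)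
  set S' := S.filter fun x => t ≤ (univ.filter fun i => x ∈ D i).card with hS'
  have h1 : ∑ x ∈ S, ((univ.filter fun i => x ∈ D i).card : ℝ) = ∑ i, ((D i).card : ℝ) := by
    norm_cast
    simp_rw [card_filter]
    rw [sum_comm]
    refine sum_congr rfl fun i _ => ?_
    rw [← card_filter, filter_mem_eq_inter, inter_eq_right.2 (hD i)]
  have h2 : (G : ℝ) * (ε * S.card) ≤ ∑ i, ((D i).card : ℝ) := by
    rw [hGdef, ← nsmul_eq_mul]
    exact card_nsmul_le_sum _ _ _ fun i _ => hcard i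
  have h3 : ∑ x ∈ S, ((univ.filter fun i => x ∈ D i).card : ℝ) ≤ G * S'.card + t * S.card := by
    calc _ ≤ ∑ x ∈ S, ((if t ≤ (univ.filter fun i => x ∈ D i).card then (G : ℝ) else 0) + t) := by
          refine sum_le_sum fun x _ => ?_
          split_ifs with h
          · have : (univ.filter fun i => x ∈ D i).card ≤ G := card_le_univ _
            have : ((univ.filter fun i => x ∈ D i).card : ℝ) ≤ G := by exact_mod_cast this
            linarith [(Nat.cast_nonneg t : (0 : ℝ) ≤ t)]
          · rw [zero_add]
            exact_mod_cast (not_le.1 h).le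
      _ = _ := by
        rw [sum_add_distrib, ← sum_filter, sum_const, sum_const, nsmul_eq_mul, nsmul_eq_mul]
        ring
  have hGpos : (0 : ℝ) < G := by exact_mod_cast ht.trans_le htG
  have h4 : ε / 2 * S.card ≤ S'.card := by
    have : (G : ℝ) * (ε / 2 * S.card) ≤ G * S'.card := by
      have := mul_le_mul_of_nonneg_right hG (Nat.cast_nonneg S.card : (0 : ℝ) ≤ S.card)
      linarith
    exact le_of_mul_le_mul_left this hGpos
  have h5 : S' ⊆ (powersetCard t (univ : Finset ι)).biUnion
      fun I => S.filter fun x => ∀ i ∈ I, x ∈ D i := by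
    intro x hx
    rw [hS', mem_filter] at hx
    obtain ⟨I, hI, hIc⟩ := exists_subset_card_eq hx.2
    rw [mem_biUnion]
    exact ⟨I, mem_powersetCard.2 ⟨subset_univ _, hIc⟩,
      mem_filter.2 ⟨hx.1, fun i hi => (mem_filter.1 (hI hi)).2⟩⟩
  have h6 : (S'.card : ℝ) ≤ ∑ I ∈ powersetCard t (univ : Finset ι),
      ((S.filter fun x => ∀ i ∈ I, x ∈ D i).card : ℝ) := by
    exact_mod_cast (card_le_card h5).trans card_biUnion_le
  have h7 : ∑ _I ∈ powersetCard t (univ : Finset ι), ε / 2 ^ (G + 1) * S.card ≤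
      ∑ I ∈ powersetCard t (univ : Finset ι),
        ((S.filter fun x => ∀ i ∈ I, x ∈ D i).card : ℝ) := by
    refine le_trans ?_ (h4.trans h6)
    have h8 : ((powersetCard t (univ : Finset ι)).card : ℝ) ≤ 2 ^ G := by
      rw [card_powersetCard, card_univ]
      exact_mod_cast Nat.choose_le_two_pow G t
    rw [sum_const, nsmul_eq_mul]
    calc _ ≤ 2 ^ G * (ε / 2 ^ (G + 1) * S.card) := by gcongr
      _ = _ := by rw [pow_succ]; field_simp
  obtain ⟨I, hI, h⟩ := exists_le_of_sum_le (powersetCard_nonempty.2 (by rwa [card_univ])) h7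
  exact ⟨I, (mem_powersetCard.1 hI).2, h⟩

/-- Dense sets of `r`-tuples contain complete `r`-partite blow-ups avoiding a bounded set. -/
lemma exists_complete_partite (r t f : ℕ) {ε : ℝ} (hε : 0 < ε) (hε1 : ε ≤ 1) :
    ∃ N : ℕ, ∀ {V : Type*} [DecidableEq V] (U F : Finset V) (R : Finset (Fin r → V)),
      N ≤ U.card → R ⊆ Fintype.piFinset (fun _ => U) → ε * (U.card : ℝ) ^ r ≤ R.card →
      F.card ≤ f → ∃ A : Fin r → Fin t → V,
        (Function.Injective fun p : Fin r × Fin t => A p.1 p.2) ∧ (∀ i j, A i j ∈ U \ F) ∧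
        ∀ φ : Fin r → Fin t, (fun i => A i (φ i)) ∈ R := by
  induction r generalizing ε f with
  | zero =>
    refine ⟨0, fun {V} _ U F R _ _ hR _ => ⟨fun i => i.elim0, fun p => p.1.elim0,
      fun i => i.elim0, fun φ => ?_⟩⟩
    have hpos : 0 < R.card := by
      have : (0 : ℝ) < R.card := hε.trans_le (by simpa using hR)
      exact_mod_cast this
    obtain ⟨w, hw⟩ := card_pos.1 hpos
    rwa [Subsingleton.elim (fun i : Fin 0 => _) w]
  | succ r ih =>
    set G := ⌈2 * (t : ℝ) / (ε / 2)⌉₊ with hG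
    obtain ⟨N, hN⟩ := ih (f + G) (ε := ε / 2 / 2 ^ (G + 1)) (by positivity) (by
      rw [div_le_one (by positivity)]
      exact (by linarith : ε / 2 ≤ 1).trans (one_le_pow₀ one_le_two))
    refine ⟨max N (max 1 ⌈(f + G : ℝ) / (ε / 2)⌉₊), fun {V} _ U F R hU hRU hR hF => ?_⟩
    set u := U.card with hu
    have hu0 : (0 : ℝ) < u := by
      have : 0 < u := by omega
      exact_mod_cast this
    set Lk : V → Finset (Fin r → V) := fun x =>
      (Fintype.piFinset fun _ => U).filter fun w => Fin.cons x w ∈ R with hLk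
    have hLkc : ∀ x, ((Lk x).card : ℝ) ≤ (u : ℝ) ^ r := fun x => by
      have : (Lk x).card ≤ u ^ r := by
        simpa [Fintype.card_piFinset] using card_filter_le (Fintype.piFinset fun _ : Fin r => U)
          (fun w => Fin.cons x w ∈ R)
      exact_mod_cast this
    have hsum : R.card ≤ ∑ x ∈ U, (Lk x).card := by
      rw [← card_sigma]
      refine card_le_card_of_injOn (fun w => ⟨w 0, Fin.tail w⟩) ?_ ?_
      · intro w hw
        have hwU := Fintype.mem_piFinset.1 (hRU hw)
        simp only [coe_sigma, Set.mem_sigma_iff, mem_coe, hLk, mem_filter, Fintype.mem_piFinset]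
        exact ⟨hwU 0, fun i => hwU i.succ, by rw [Fin.cons_self_tail]; exact hw⟩
      · intro w _ w' _ h
        simp only [Sigma.mk.injEq, heq_eq_eq] at h
        rw [← Fin.cons_self_tail w, ← Fin.cons_self_tail w', h.1, h.2]
    set Hv := U.filter fun x => ε / 2 * (u : ℝ) ^ r ≤ (Lk x).card with hHv
    have hHvc : ε / 2 * u ≤ Hv.card := by
      have h1 : (R.card : ℝ) ≤ ∑ x ∈ U, ((Lk x).card : ℝ) := by exact_mod_cast hsum
      have h2 : ∑ x ∈ U, ((Lk x).card : ℝ) ≤ ∑ x ∈ U,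
          ((if ε / 2 * (u : ℝ) ^ r ≤ (Lk x).card then (u : ℝ) ^ r else 0) + ε / 2 * (u : ℝ) ^ r) := by
        refine sum_le_sum fun x _ => ?_
        split_ifs with h
        · have : 0 ≤ ε / 2 * (u : ℝ) ^ r := by positivity
          linarith [hLkc x]
        · linarith
      rw [sum_add_distrib, ← sum_filter, sum_const, sum_const, nsmul_eq_mul, nsmul_eq_mul] at h2
      rw [pow_succ] at hR
      have h3 : (u : ℝ) ^ r * (ε / 2 * u) ≤ u ^ r * Hv.card := by
        linarith
      exact le_of_mul_le_mul_left h3 (by positivity)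
    have hHG : G ≤ (Hv \ F).card := by
      have h1 : (f + G : ℝ) / (ε / 2) ≤ u := by
        refine (Nat.le_ceil _).trans ?_
        exact_mod_cast (by omega : ⌈(f + G : ℝ) / (ε / 2)⌉₊ ≤ u)
      rw [div_le_iff₀ (by positivity)] at h1
      have h2 : f + G ≤ Hv.card := by
        have : (f + G : ℝ) ≤ Hv.card := by linarith
        exact_mod_cast this
      have := le_card_sdiff F Hv
      omega
    obtain ⟨T, hT, hTc⟩ := exists_subset_card_eq hHG
    have hcard : Fintype.card T = G := by simpa using hTc
    have hTH : ∀ x : T, x.1 ∈ U ∧ ε / 2 * (u : ℝ) ^ r ≤ (Lk x).card ∧ x.1 ∉ F := fun x => by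
      have := hT x.2
      rw [mem_sdiff, hHv, mem_filter] at this
      exact ⟨this.1.1, this.1.2, this.2⟩
    obtain ⟨I, hI, hIc⟩ := exists_common_intersection (Fintype.piFinset fun _ : Fin r => U)
      (fun x : T => Lk x) (fun x => filter_subset _ _) (ε := ε / 2) (by positivity) (by linarith) t
      (fun x => by simpa [Fintype.card_piFinset] using (hTH x).2.1) (by
        rw [hcard, ← div_le_iff₀ (by positivity)]
        exact Nat.le_ceil _)
    rw [hcard] at hIc
    obtain ⟨A, hA, hAU, hAR⟩ := hN U (F ∪ T) _ (by omega) (filter_subset _ _)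
      (by simpa [Fintype.card_piFinset] using hIc) (by have := card_union_le F T; omega)
    set e := I.equivFinOfCardEq hI with he
    refine ⟨Fin.cons (fun j => (e.symm j).1.1) A, ?_, ?_, ?_⟩
    · rintro ⟨i, j⟩ ⟨i', j'⟩ h
      induction i using Fin.cases with
      | zero =>
        induction i' using Fin.cases with
        | zero =>
          simp only [Fin.cons_zero, Subtype.coe_inj, EmbeddingLike.apply_eq_iff_eq] at h
          rw [h]
        | succ i' =>
          simp only [Fin.cons_zero, Fin.cons_succ] at h
          have := hAU i' j'
          simp [← h] at this
      | succ i =>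
        induction i' using Fin.cases with
        | zero =>
          simp only [Fin.cons_zero, Fin.cons_succ] at h
          have := hAU i j
          simp [h] at this
        | succ i' =>
          simp only [Fin.cons_succ] at h
          have := @hA (i, j) (i', j') h
          simp only [Prod.mk.injEq] at this
          rw [this.1, this.2]
    · intro i j
      induction i using Fin.cases with
      | zero =>
        have := hTH (e.symm j).1
        simpa using ⟨this.1, this.2.2⟩
      | succ i =>
        have := hAU i j
        simp only [mem_sdiff, mem_union, not_or] at this
        simpa using ⟨this.1, this.2.1⟩
    · intro φ
      have h := (mem_filter.1 (hAR (Fin.tail φ))).2 _ (e.symm (φ 0)).1.2 (e.symm (φ 0)).2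
      have h2 := (mem_filter.1 h).2
      convert h2 using 1
      ext i
      induction i using Fin.cases <;> rfl

lemma spans_of_cells {V : Type*} [DecidableEq V] {k l : ℕ} {E : Finset (Finset V)}
    (hl1 : 1 ≤ l) (hl : 2 * l < k) (C O Z : ℕ → Finset V) (g : ℕ → V) (t : ℕ)
    (hC : ∀ c ≤ 2 * t, (C c).card = l) (hO : ∀ c ≤ 2 * t, (O c).card = l - 1)
    (hZ : ∀ c ≤ 2 * t, (Z c).card = k - 2 * l)
    (hd : ∀ c ≤ 2 * t, Disjoint (C c) (Z c) ∧ Disjoint (O c) (Z c))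
    (hdd : ∀ c c', c < c' → c' ≤ 2 * t → Disjoint (C c ∪ O c ∪ Z c) (C c' ∪ O c' ∪ Z c'))
    (hg : ∀ i j, i < j → j < t → g i ≠ g j)
    (hgc : ∀ j < t, ∀ c ≤ 2 * t, g j ∉ C c ∪ O c ∪ Z c)
    (he : ∀ j < t, ∀ c ≤ 2 * t, ∀ c' ≤ 2 * t, ∀ c'' ≤ 2 * t,
      insert (g j) (O c ∪ Z c' ∪ C c'') ∈ E) :
    ∃ B X, Spans k l E (C (2 * t)) B X ∧ X.card = 2 * t * (k - l) + l ∧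
      X ⊆ (range (2 * t + 1)).biUnion (fun c => C c ∪ O c ∪ Z c) ∪ (range t).image g := by
  induction t with
  | zero =>
    have h0 := hC 0 le_rfl
    refine ⟨C 0, C 0, .base _ h0, by simpa using h0, ?_⟩
    intro x hx
    simp [hx]
  | succ t ih =>
    obtain ⟨B, X, hX, hXc, hXs⟩ := ih (fun c hc => hC c (by omega)) (fun c hc => hO c (by omega))
      (fun c hc => hZ c (by omega)) (fun c hc => hd c (by omega))
      (fun c c' h hc => hdd c c' h (by omega)) (fun i j h hj => hg i j h (by omega))
      (fun j hj c hc => hgc j (by omega) c (by omega))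
      (fun j hj c hc c' hc' c'' hc'' => he j (by omega) c (by omega) c' (by omega) c'' (by omega))
    have hcell : ∀ c, 2 * t < c → c ≤ 2 * (t + 1) → Disjoint (C c ∪ O c ∪ Z c) X := by
      intro c h1 h2
      refine Disjoint.mono_right hXs ?_
      rw [disjoint_union_right, disjoint_biUnion_right]
      refine ⟨fun c' hc' => (hdd c' c (by rw [mem_range] at hc'; omega) h2).symm, ?_⟩
      rw [disjoint_left]
      intro x hx hx'
      obtain ⟨j, hj, rfl⟩ := mem_image.1 hx'
      exact hgc j (by rw [mem_range] at hj; omega) c h2 hx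
    have hgX : g t ∉ X := by
      intro h
      rcases mem_union.1 (hXs h) with h | h
      · obtain ⟨c, hc, h⟩ := mem_biUnion.1 h
        exact hgc t (by omega) c (by rw [mem_range] at hc; omega) h
      · obtain ⟨j, hj, h⟩ := mem_image.1 h
        exact hg j t (mem_range.1 hj) (by omega) h
    have h1 := hcell (2 * t + 1) (by omega) (by omega)
    have h2 := hcell (2 * t + 2) (by omega) (by omega)
    have h12 := hdd (2 * t + 1) (2 * t + 2) (by omega) (by omega)
    have hg1 := hgc t (by omega) (2 * t + 1) (by omega)
    have hg2 := hgc t (by omega) (2 * t + 2) (by omega)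
    have d1 := hd (2 * t + 1) (by omega)
    have d2 := hd (2 * t + 2) (by omega)
    simp only [disjoint_union_left, disjoint_union_right, mem_union, not_or] at h1 h2 h12 hg1 hg2
    have e1 := he t (by omega) (2 * t + 1) (by omega) (2 * t + 1) (by omega) (2 * t) (by omega)
    have e2 := he t (by omega) (2 * t + 1) (by omega) (2 * t + 2) (by omega) (2 * t + 2) (by omega)
    have hA1 : (insert (g t) (O (2 * t + 1))).card = l := by
      rw [card_insert_of_notMem hg1.1.2, hO _ (by omega)]
      omega
    have hS1 := Spans.step hX hA1 (hZ (2 * t + 1) (by omega))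
      (by rw [disjoint_insert_left]; exact ⟨hg1.2, d1.2⟩)
      (by
        rw [disjoint_union_left, disjoint_insert_left]
        exact ⟨⟨hgX, h1.1.2⟩, h1.2⟩) (by simpa [insert_union] using e1)
    have hdis : Disjoint (C (2 * t + 2) ∪ Z (2 * t + 2))
        (insert (g t) (O (2 * t + 1)) ∪ Z (2 * t + 1) ∪ X) := by
      simp only [disjoint_union_left, disjoint_union_right, disjoint_insert_right, mem_union, not_or]
      exact ⟨⟨⟨⟨hg2.1.1, hg2.2⟩, h12.1.1.1.2.symm, h12.2.1.2.symm⟩, h12.1.1.2.symm, h12.2.2.symm⟩,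
        h2.1.1, h2.2⟩
    have hS2 := Spans.step hS1 (hC (2 * t + 2) (by omega)) (hZ (2 * t + 2) (by omega)) d2.1 hdis
      (by
        convert e2 using 1
        simp only [union_insert]
        congr 1
        ac_rfl)
    refine ⟨B, _, hS2, ?_, ?_⟩
    · rw [card_union_of_disjoint hdis, card_union_of_disjoint d2.1, card_union_of_disjoint,
        card_union_of_disjoint, hA1, hXc, hC _ (by omega), hZ _ (by omega), hZ _ (by omega)]
      · have : k - l = l + (k - 2 * l) := by omega
        rw [this]
        ring
      · rw [disjoint_insert_left]; exact ⟨hg1.2, d1.2⟩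
      · rw [disjoint_union_left, disjoint_insert_left]
        exact ⟨⟨hgX, h1.1.2⟩, h1.2⟩
    · intro x hx
      rw [show 2 * (t + 1) + 1 = 2 * t + 1 + 1 + 1 by ring, range_add_one, biUnion_insert,
        range_add_one, biUnion_insert, range_add_one (n := t), image_insert]
      have := @hXs x
      simp only [mem_union, mem_insert] at hx this ⊢
      grind only

/-- Complete partite blow-ups of links contain `l`-paths. -/
lemma exists_spans_of_partite {V : Type*} [DecidableEq V] {k l : ℕ} {E : Finset (Finset V)}
    (hl1 : 1 ≤ l) (hl : 2 * l < k) (t : ℕ) (A : Fin (k - 1) → Fin (2 * t + 1) → V)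
    (hA : Function.Injective fun p : Fin (k - 1) × Fin (2 * t + 1) => A p.1 p.2)
    (g : Fin t → V) (hg : Function.Injective g) (hgA : ∀ i j c, g i ≠ A j c)
    (he : ∀ (i : Fin t) (φ : Fin (k - 1) → Fin (2 * t + 1)), insert (g i) (univ.image fun j => A j (φ j)) ∈ E) :
    ∃ B B' X, Spans k l E B B' X ∧ X.card = 2 * t * (k - l) + l ∧
      ∀ x ∈ X, (∃ j c, x = A j c) ∨ ∃ i, x = g i := by
  obtain ⟨I, J, hI, hJL', hIJ, hu⟩ := exists_union_of_card_add (X := (univ : Finset (Fin (k - 1))))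
    (a := l) (b := (l - 1) + (k - 2 * l)) (by rw [card_univ, Fintype.card_fin]; omega)
  obtain ⟨J, L, hJ, hL, hJL, rfl⟩ := exists_union_of_card_add hJL'
  rw [disjoint_union_right] at hIJ
  rcases Nat.eq_zero_or_pos t with rfl | ht
  · refine ⟨_, _, I.image fun j => A j 0, .base _ ?_, ?_, ?_⟩
    · rw [card_image_of_injective _ fun a b h => congrArg Prod.fst (@hA (a, 0) (b, 0) h), hI]
    · rw [card_image_of_injective _ fun a b h => congrArg Prod.fst (@hA (a, 0) (b, 0) h), hI]
      simp
    · intro x hx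
      obtain ⟨j, -, rfl⟩ := mem_image.1 hx
      exact .inl ⟨j, 0, rfl⟩
  have : NeZero t := ⟨ht.ne'⟩
  set f : ℕ → Fin (2 * t + 1) := Fin.ofNat (2 * t + 1) with hf
  have hfi : ∀ c ≤ 2 * t, ∀ c' ≤ 2 * t, f c = f c' → c = c' := by
    intro c hc c' hc' h
    have := congrArg Fin.val h
    simp only [hf, Fin.val_ofNat] at this
    rwa [Nat.mod_eq_of_lt (by omega), Nat.mod_eq_of_lt (by omega)] at this
  have hinj : ∀ c, Function.Injective fun j => A j (f c) :=
    fun c a b h => congrArg Prod.fst (@hA (a, f c) (b, f c) h)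
  have hAne : ∀ {j j' c c'}, A j c = A j' c' → j = j' ∧ c = c' := fun {j j' c c'} h => by
    simpa using @hA (j, c) (j', c') h
  obtain ⟨B, X, hX, hXc, hXs⟩ := spans_of_cells (E := E) hl1 hl
    (fun c => I.image fun j => A j (f c)) (fun c => J.image fun j => A j (f c))
    (fun c => L.image fun j => A j (f c)) (fun j => g (Fin.ofNat t j)) t
    (fun c _ => by rw [card_image_of_injective _ (hinj c), hI])
    (fun c _ => by rw [card_image_of_injective _ (hinj c), hJ])
    (fun c _ => by rw [card_image_of_injective _ (hinj c), hL])
    (fun c _ => ⟨(disjoint_image (hinj c)).2 hIJ.2, (disjoint_image (hinj c)).2 hJL⟩)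
    (fun c c' hcc hc' => by
      rw [disjoint_left]
      intro x hx hx'
      simp only [mem_union, mem_image] at hx hx'
      have h1 : ∃ j, A j (f c) = x := by
        rcases hx with (⟨j, -, h⟩ | ⟨j, -, h⟩) | ⟨j, -, h⟩ <;> exact ⟨j, h⟩
      have h2 : ∃ j, A j (f c') = x := by
        rcases hx' with (⟨j, -, h⟩ | ⟨j, -, h⟩) | ⟨j, -, h⟩ <;> exact ⟨j, h⟩
      obtain ⟨j, hj⟩ := h1
      obtain ⟨j', rfl⟩ := h2
      exact hcc.ne (hfi _ (by omega) _ hc' (hAne hj).2))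
    (fun i j hij hj h => by
      have := congrArg Fin.val (hg h)
      simp only [Fin.val_ofNat] at this
      rw [Nat.mod_eq_of_lt (by omega), Nat.mod_eq_of_lt (by omega)] at this
      omega)
    (fun j hj c hc h => by
      simp only [mem_union, mem_image] at h
      rcases h with (⟨j, -, h⟩ | ⟨j, -, h⟩) | ⟨j, -, h⟩ <;> exact hgA _ _ _ h.symm)
    (fun j hj c hc c' hc' c'' hc'' => by
      convert he (Fin.ofNat t j) fun i => if i ∈ I then f c'' else if i ∈ J then f c else f c'
        using 2
      rw [hu, image_union, image_union, union_comm]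
      congr 1
      · refine image_congr fun i hi => ?_
        rw [mem_coe] at hi
        simp [hi]
      congr 1
      · refine image_congr fun i hi => ?_
        rw [mem_coe] at hi
        simp [hi, disjoint_right.1 hIJ.1 hi]
      · refine image_congr fun i hi => ?_
        rw [mem_coe] at hi
        simp [disjoint_right.1 hIJ.2 hi, disjoint_right.1 hJL hi])
  refine ⟨_, B, X, hX, hXc, fun x hx => ?_⟩
  have := hXs hx
  simp only [mem_union, mem_biUnion, mem_image] at this
  rcases this with ⟨c, -, (⟨j, -, h⟩ | ⟨j, -, h⟩) | ⟨j, -, h⟩⟩ | ⟨i, -, h⟩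
  · exact .inl ⟨j, _, h.symm⟩
  · exact .inl ⟨j, _, h.symm⟩
  · exact .inl ⟨j, _, h.symm⟩
  · exact .inr ⟨_, h.symm⟩

/-- The `r`-tuples in `U` completing the vertex `v` to an edge of `E`. -/
def linkTuples {V : Type*} [DecidableEq V] (E : Finset (Finset V)) (r : ℕ) (U : Finset V) (v : V) :
    Finset (Fin r → V) :=
  (Fintype.piFinset fun _ => U).filter fun w => insert v (univ.image w) ∈ E

lemma le_card_of_le_prod {ι : Type*} [Fintype ι] [DecidableEq ι] {P δ : ℝ} (hP : 0 < P)
    {R : ι → ℝ} (hR0 : ∀ i, 0 ≤ R i) (hR : ∀ i, R i ≤ P)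
    (h : δ * P ^ Fintype.card ι ≤ ∏ i, R i) (i : ι) : δ * P ≤ R i := by
  rw [← mul_prod_erase univ R (mem_univ i)] at h
  have h1 : ∏ j ∈ univ.erase i, R j ≤ P ^ (Fintype.card ι - 1) := by
    calc _ ≤ ∏ _j ∈ univ.erase i, P := prod_le_prod (fun j _ => hR0 j) fun j _ => hR j
      _ = _ := by rw [prod_const, card_erase_of_mem (mem_univ i), card_univ]
  have h2 : P ^ Fintype.card ι = P * P ^ (Fintype.card ι - 1) := by
    rw [← pow_succ', Nat.sub_add_cancel (Fintype.card_pos_iff.2 ⟨i⟩)]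
  have h3 : (δ * P) * P ^ (Fintype.card ι - 1) ≤ R i * P ^ (Fintype.card ι - 1) := by
    calc _ = δ * P ^ Fintype.card ι := by rw [h2]; ring
      _ ≤ _ := h
      _ ≤ _ := mul_le_mul_of_nonneg_left h1 (hR0 i)
  exact le_of_mul_le_mul_right h3 (by positivity)

/-- Many rows of vertices with dense links in `U` contain `t` rows from which `h` disjoint `l`-paths
with `2 * t` edges can be built using further vertices of `U` only. -/
lemma exists_paths_of_dense_links (k l t h : ℕ) (hl1 : 1 ≤ l) (hl : 2 * l < k) {ε : ℝ} (hε : 0 < ε)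
    (hε1 : ε ≤ 1) : ∃ G N : ℕ, ∀ {V : Type*} [DecidableEq V] (E : Finset (Finset V)) (U : Finset V)
      (g : Fin G → Fin h → V), (Function.Injective fun p : Fin G × Fin h => g p.1 p.2) →
      N ≤ U.card →
      (∀ i a, ε * (U.card : ℝ) ^ (k - 1) ≤ (linkTuples E (k - 1) U (g i a)).card) →
      ∃ (I : Finset (Fin G)) (X : Fin h → Finset V), I.card = t ∧
        (∀ a, (∃ A B, Spans k l E A B (X a)) ∧ (X a).card = 2 * t * (k - l) + l ∧
          ∀ x ∈ X a, x ∈ U ∨ ∃ i ∈ I, ∃ b, x = g i b) ∧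
        ∀ a b, a ≠ b → Disjoint (X a) (X b) := by
  set G := ⌈2 * (t : ℝ) / ε ^ h⌉₊ with hG
  set s := 2 * t * (k - l) + l with hs
  obtain ⟨N, hN⟩ := exists_complete_partite (k - 1) (2 * t + 1) (G * h + h * s)
    (ε := ε ^ h / 2 ^ (G + 1)) (by positivity) (by
      rw [div_le_one (by positivity)]
      exact (pow_le_one₀ hε.le hε1).trans (one_le_pow₀ one_le_two))
  refine ⟨G, max N 1, fun {V} _ E U g hg hU hD => ?_⟩
  have hu : (0 : ℝ) < U.card := by exact_mod_cast (by omega : 0 < U.card)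
  set P : Finset (Fin (k - 1) → V) := Fintype.piFinset fun _ => U with hPdef
  have hPc : (P.card : ℝ) = (U.card : ℝ) ^ (k - 1) := by simp [hPdef, Fintype.card_piFinset]
  have hPpos : (0 : ℝ) < P.card := by rw [hPc]; positivity
  have hPh : ((Fintype.piFinset fun _ : Fin h => P).card : ℝ) = (P.card : ℝ) ^ h := by
    rw [Fintype.card_piFinset_const, Nat.cast_pow]
  obtain ⟨I, hI, hIc⟩ := exists_common_intersection (Fintype.piFinset fun _ : Fin h => P)
    (fun i => Fintype.piFinset fun a => linkTuples E (k - 1) U (g i a))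
    (fun i => Fintype.piFinset_subset _ _ fun a => filter_subset _ _) (ε := ε ^ h) (by positivity)
    (pow_le_one₀ hε.le hε1) t (fun i => by
      rw [hPh, hPc, ← mul_pow, Fintype.card_piFinset, Nat.cast_prod]
      calc _ = ∏ _a : Fin h, ε * (U.card : ℝ) ^ (k - 1) := by simp
        _ ≤ _ := prod_le_prod (fun a _ => by positivity) fun a _ => hD i a)
    (by
      rw [Fintype.card_fin, ← div_le_iff₀ (by positivity)]
      exact Nat.le_ceil _)
  set R : Fin h → Finset (Fin (k - 1) → V) := fun a =>
    P.filter fun w => ∀ i ∈ I, w ∈ linkTuples E (k - 1) U (g i a) with hRdef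
  have hR : ∀ a, ε ^ h / 2 ^ (G + 1) * (U.card : ℝ) ^ (k - 1) ≤ (R a).card := by
    have hsub : ((Fintype.piFinset fun _ : Fin h => P).filter fun ω => ∀ i ∈ I,
        ω ∈ Fintype.piFinset fun a => linkTuples E (k - 1) U (g i a)) ⊆ Fintype.piFinset R := by
      intro ω hω
      simp only [mem_filter, Fintype.mem_piFinset] at hω
      rw [Fintype.mem_piFinset]
      exact fun a => mem_filter.2 ⟨hω.1 a, fun i hi => hω.2 i hi a⟩
    have hc : (_ : ℝ) ≤ ((Fintype.piFinset R).card : ℝ) :=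
      hIc.trans (Nat.cast_le.2 (by convert card_le_card hsub))
    have hRc : ((Fintype.piFinset R).card : ℝ) = ∏ a, ((R a).card : ℝ) := by
      rw [Fintype.card_piFinset, Nat.cast_prod]
    rw [hPh, hRc, Fintype.card_fin] at hc
    rw [← hPc]
    exact le_card_of_le_prod hPpos (fun a => Nat.cast_nonneg _)
      (fun a => by exact_mod_cast card_filter_le _ _) (by rw [Fintype.card_fin]; exact hc)
  set allg : Finset V := univ.image fun p : Fin G × Fin h => g p.1 p.2 with hallg
  have hallgc : allg.card ≤ G * h := by
    simpa using (card_image_le : allg.card ≤ (univ : Finset (Fin G × Fin h)).card)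
  have hmemg : ∀ i a, g i a ∈ allg := fun i a => mem_image.2 ⟨(i, a), mem_univ _, rfl⟩
  have key : ∀ S : Finset (Fin h), ∃ X : Fin h → Finset V,
      (∀ a ∈ S, (∃ A B, Spans k l E A B (X a)) ∧ (X a).card = s ∧
        ∀ x ∈ X a, (x ∈ U ∧ x ∉ allg) ∨ ∃ i ∈ I, x = g i a) ∧
      ∀ a ∈ S, ∀ b ∈ S, a ≠ b → Disjoint (X a) (X b) := by
    intro S
    induction S using Finset.induction_on with
    | empty => exact ⟨fun _ => ∅, by simp⟩
    | insert a S ha ih =>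
      obtain ⟨X, hX, hXd⟩ := ih
      have hF : (allg ∪ S.biUnion X).card ≤ G * h + h * s := by
        refine (card_union_le _ _).trans (add_le_add hallgc ?_)
        refine (card_biUnion_le_card_mul S X s fun b hb => (hX b hb).2.1.le).trans ?_
        gcongr
        simpa using card_le_univ S
      obtain ⟨A, hA, hAU, hAR⟩ := hN U (allg ∪ S.biUnion X) (R a) (by omega)
        (filter_subset _ _) (hR a) hF
      set e := I.equivFinOfCardEq hI with he
      obtain ⟨B, B', Y, hY, hYc, hYs⟩ := exists_spans_of_partite (E := E) hl1 hl t A hA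
        (fun i => g (e.symm i).1 a)
        (fun i j hij => by
          have := @hg ((e.symm i).1, a) ((e.symm j).1, a) hij
          simpa [Subtype.coe_inj] using this)
        (fun i j c hij => by
          have := hAU j c
          rw [← hij] at this
          simp [hmemg] at this)
        (fun i φ => by
          have h1 := (mem_filter.1 (hAR φ)).2 _ (e.symm i).2
          exact (mem_filter.1 h1).2)
      have hYs' : ∀ x ∈ Y, (x ∈ U ∧ x ∉ allg ∧ ∀ b ∈ S, x ∉ X b) ∨ ∃ i ∈ I, x = g i a := by
        intro x hx
        rcases hYs x hx with ⟨j, c, rfl⟩ | ⟨i, rfl⟩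
        · have := hAU j c
          simp only [mem_sdiff, mem_union, mem_biUnion, not_or, not_exists, not_and] at this
          exact .inl ⟨this.1, this.2.1, this.2.2⟩
        · exact .inr ⟨_, (e.symm i).2, rfl⟩
      have hdis : ∀ b ∈ S, Disjoint Y (X b) := by
        intro b hb
        rw [disjoint_left]
        intro x hx hxb
        rcases hYs' x hx with h1 | ⟨i, hi, rfl⟩
        · exact h1.2.2 b hb hxb
        · rcases (hX b hb).2.2 _ hxb with h2 | ⟨j, -, h2⟩
          · exact h2.2 (hmemg _ _)
          · have := @hg (i, a) (j, b) h2
            simp only [Prod.mk.injEq] at this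
            exact ha (this.2 ▸ hb)
      have hne : ∀ b ∈ S, b ≠ a := fun b hb => by rintro rfl; exact ha hb
      refine ⟨Function.update X a Y, ?_, ?_⟩
      · intro b hb
        rcases mem_insert.1 hb with rfl | hb
        · simp only [Function.update_self]
          refine ⟨⟨B, B', hY⟩, hYc, fun x hx => ?_⟩
          rcases hYs' x hx with h1 | h1
          · exact .inl ⟨h1.1, h1.2.1⟩
          · exact .inr h1
        · rw [Function.update_of_ne (hne b hb)]
          exact hX b hb
      · intro b hb c hc hbc
        rcases mem_insert.1 hb with rfl | hb'
        · rcases mem_insert.1 hc with rfl | hc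
          · exact absurd rfl hbc
          · rw [Function.update_self, Function.update_of_ne (hne c hc)]
            exact hdis c hc
        · rcases mem_insert.1 hc with rfl | hc
          · rw [Function.update_self, Function.update_of_ne (hne b hb')]
            exact (hdis b hb').symm
          · rw [Function.update_of_ne (hne b hb'), Function.update_of_ne (hne c hc)]
            exact hXd b hb' c hc hbc
  obtain ⟨X, hX, hXd⟩ := key univ
  refine ⟨I, X, hI, fun a => ⟨(hX a (mem_univ _)).1, (hX a (mem_univ _)).2.1, fun x hx => ?_⟩,
    fun a b => hXd a (mem_univ _) b (mem_univ _)⟩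
  rcases (hX a (mem_univ _)).2.2 x hx with h1 | ⟨i, hi, h1⟩
  · exact .inl h1.1
  · exact .inr ⟨i, hi, a, h1⟩

section DenseLinks
variable {V : Type*} [Fintype V] [DecidableEq V] {E : Finset (Finset V)}

lemma sum_card_linkTuples_ge {U W : Finset V} {r : ℕ} {D : ℝ} (hD0 : 0 ≤ D)
    (hD : ∀ S ⊆ U, S.card = r → D ≤ ((linkVerts E S ∩ W).card : ℝ)) :
    ((U.card - r : ℕ) : ℝ) ^ r * D ≤ ∑ v ∈ W, ((linkTuples E r U v).card : ℝ) := by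
  classical
  set P : Finset (Fin r → V) := Fintype.piFinset fun _ => U with hP
  set J := P.filter fun w => (univ.image w).card = r with hJ
  have hJP : ∀ w ∈ J, univ.image w ⊆ U ∧ (univ.image w).card = r := by
    intro w hw
    rw [hJ, mem_filter, hP, Fintype.mem_piFinset] at hw
    refine ⟨fun x hx => ?_, hw.2⟩
    obtain ⟨i, -, rfl⟩ := mem_image.1 hx
    exact hw.1 i
  have hJc : (U.card - r) ^ r ≤ J.card := by
    rcases le_or_gt U.card r with h | h
    · rcases Nat.eq_zero_or_pos r with rfl | hr
      · simp [hJ, hP]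
      · rw [Nat.sub_eq_zero_of_le h, zero_pow hr.ne']
        exact Nat.zero_le _
    · have hm := (many_free (V := V) (d := U.card - r) le_rfl r Uᶜ (by
        have := card_le_univ U
        rw [card_compl]; omega)).card_le
      refine hm.trans (card_le_card fun w hw => ?_)
      simp only [mem_filter, mem_univ, true_and] at hw
      rw [hJ, mem_filter, hP, Fintype.mem_piFinset]
      refine ⟨fun i => ?_, hw.1⟩
      have := disjoint_left.1 hw.2 (mem_image_of_mem w (mem_univ i))
      simpa using this
  have hswap : ∑ v ∈ W, (linkTuples E r U v).card
      = ∑ w ∈ P, (W.filter fun v => insert v (univ.image w) ∈ E).card :=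
    sum_card_bipartiteAbove_eq_sum_card_bipartiteBelow fun v w => insert v (univ.image w) ∈ E
  rw [← Nat.cast_sum, hswap, Nat.cast_sum]
  calc ((U.card - r : ℕ) : ℝ) ^ r * D ≤ J.card * D := by
        gcongr
        exact_mod_cast hJc
    _ = ∑ w ∈ J, D := by rw [sum_const, nsmul_eq_mul]
    _ ≤ ∑ w ∈ J, ((W.filter fun v => insert v (univ.image w) ∈ E).card : ℝ) := by
        refine sum_le_sum fun w hw => (hD _ (hJP w hw).1 (hJP w hw).2).trans ?_
        refine Nat.cast_le.2 (card_le_card fun v hv => ?_)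
        rw [mem_inter, mem_linkVerts] at hv
        exact mem_filter.2 ⟨hv.2, hv.1.2⟩
    _ ≤ _ := sum_le_sum_of_subset_of_nonneg (filter_subset _ _) fun _ _ _ => Nat.cast_nonneg _

/-- Many vertices have dense links in `U`. -/
lemma card_dense_ge {U W : Finset V} {r : ℕ} {ε D : ℝ} (hε : 0 < ε) (hD0 : 0 ≤ D)
    (hD1 : D ≤ Fintype.card V)
    (hU : 0 < U.card) (hU' : (r : ℝ) ^ 2 ≤ ε * U.card)
    (hD : ∀ S ⊆ U, S.card = r → D ≤ ((linkVerts E S ∩ W).card : ℝ)) :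
    D - 2 * ε * Fintype.card V ≤
      ((W.filter fun v => ε * (U.card : ℝ) ^ r ≤ (linkTuples E r U v).card).card : ℝ) := by
  classical
  set n : ℝ := (Fintype.card V : ℝ) with hnd
  have hn : 0 ≤ n := Nat.cast_nonneg _
  set G := W.filter fun v => ε * (U.card : ℝ) ^ r ≤ (linkTuples E r U v).card with hG
  have h1 := sum_card_linkTuples_ge (E := E) hD0 hD
  have hu : (0 : ℝ) < U.card := by exact_mod_cast hU
  have hur : (0 : ℝ) < (U.card : ℝ) ^ r := by positivity
  have hbern : (1 - ε) * (U.card : ℝ) ^ r ≤ ((U.card - r : ℕ) : ℝ) ^ r := by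
    rcases le_or_gt U.card r with h | h
    · have h2 : (r : ℝ) ^ 2 ≤ ε * r := hU'.trans (by gcongr)
      have hr : (0 : ℝ) < r := by exact_mod_cast hU.trans_le h
      have h3 : (1 : ℝ) ≤ r := by exact_mod_cast hU.trans_le h
      have h4 : 1 ≤ ε := by nlinarith
      have : (0 : ℝ) ≤ ((U.card - r : ℕ) : ℝ) ^ r := by positivity
      nlinarith
    · rw [Nat.cast_sub h.le]
      have hb := one_add_mul_le_pow (a := -((r : ℝ) / U.card)) (by
        have : (r : ℝ) / U.card ≤ 1 := by
          rw [div_le_one hu]; exact_mod_cast h.le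
        linarith) r
      have hr2 : (r : ℝ) * (r / U.card) ≤ ε := by
        rw [← mul_div_assoc, div_le_iff₀ hu]; nlinarith
      have : ((U.card : ℝ) - r) ^ r = (1 + -((r : ℝ) / U.card)) ^ r * (U.card : ℝ) ^ r := by
        rw [← mul_pow]; congr 1; field_simp; ring
      rw [this]
      gcongr
      linarith
  have hmax : ∀ v, ((linkTuples E r U v).card : ℝ) ≤ (U.card : ℝ) ^ r := by
    intro v
    have : (linkTuples E r U v).card ≤ U.card ^ r := by
      refine (card_filter_le _ _).trans ?_
      rw [Fintype.card_piFinset_const]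
    exact_mod_cast this
  have hup : ∑ v ∈ W, ((linkTuples E r U v).card : ℝ)
      ≤ G.card * (U.card : ℝ) ^ r + n * (ε * (U.card : ℝ) ^ r) := by
    rw [← sum_filter_add_sum_filter_not W
      fun v => ε * (U.card : ℝ) ^ r ≤ (linkTuples E r U v).card]
    refine add_le_add ?_ ?_
    · calc _ ≤ ∑ v ∈ G, (U.card : ℝ) ^ r := sum_le_sum fun v _ => hmax v
        _ = _ := by rw [sum_const, nsmul_eq_mul]
    · refine (sum_le_card_nsmul _ _ (ε * (U.card : ℝ) ^ r) fun v hv => ?_).trans ?_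
      · exact (not_le.1 (mem_filter.1 hv).2).le
      · rw [nsmul_eq_mul]
        gcongr
        exact Nat.cast_le.2 (card_le_univ _)
  have h5 : (D - 2 * ε * n) * (U.card : ℝ) ^ r ≤ G.card * (U.card : ℝ) ^ r := by
    have h6 : (1 - ε) * (U.card : ℝ) ^ r * D ≤ ((U.card - r : ℕ) : ℝ) ^ r * D := by gcongr
    have h7 : ε * (U.card : ℝ) ^ r * D ≤ ε * (U.card : ℝ) ^ r * n := by gcongr
    nlinarith
  exact le_of_mul_le_mul_right h5 hur

end DenseLinks

/-- A family of disjoint `l`-paths on `s` vertices inside `W`. -/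
def IsTiling {V : Type*} [DecidableEq V] (k l s : ℕ) (E : Finset (Finset V)) (W : Finset V)
    (𝒯 : Finset (Finset V)) : Prop :=
  (𝒯 : Set (Finset V)).PairwiseDisjoint id ∧
    ∀ X ∈ 𝒯, X ⊆ W ∧ X.card = s ∧ ∃ A B, Spans k l E A B X

lemma IsTiling.replace {V : Type*} [DecidableEq V] {k l s : ℕ}
    {E : Finset (Finset V)} {W : Finset V} {𝒯 𝒬 : Finset (Finset V)} (h : IsTiling k l s E W 𝒯)
    (hs : 0 < s) (hQ : 𝒬 ⊆ 𝒯) {m : ℕ} (X : Fin m → Finset V)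
    (hX : ∀ a, (∃ A B, Spans k l E A B (X a)) ∧ (X a).card = s ∧
      ∀ x ∈ X a, x ∈ W \ 𝒯.biUnion id ∨ ∃ Y ∈ 𝒬, x ∈ Y)
    (hXd : ∀ a b, a ≠ b → Disjoint (X a) (X b)) :
    ∃ 𝒯', IsTiling k l s E W 𝒯' ∧ 𝒯'.card + 𝒬.card = 𝒯.card + m := by
  have hinj : Function.Injective X := by
    intro a b hab
    by_contra hne
    have h1 := hXd a b hne
    rw [← hab, disjoint_self_iff_empty] at h1
    have h2 := (hX a).2.1
    rw [h1, card_empty] at h2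
    omega
  have hdis : ∀ a, ∀ Y ∈ 𝒯 \ 𝒬, Disjoint (X a) Y := by
    intro a Y hY
    rw [mem_sdiff] at hY
    rw [disjoint_left]
    intro x hx hxY
    rcases (hX a).2.2 x hx with h1 | ⟨Z, hZ, hxZ⟩
    · rw [mem_sdiff, mem_biUnion] at h1
      exact h1.2 ⟨Y, hY.1, hxY⟩
    · have hne : Z ≠ Y := by rintro rfl; exact hY.2 hZ
      exact disjoint_left.1 (h.1 (hQ hZ) hY.1 hne) hxZ hxY
  refine ⟨(𝒯 \ 𝒬) ∪ univ.image X, ⟨?_, ?_⟩, ?_⟩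
  · intro Y hY Z hZ hYZ
    simp only [coe_union, coe_sdiff, coe_image, coe_univ, Set.image_univ, Set.mem_union,
      Set.mem_range] at hY hZ
    rcases hY with hY | ⟨a, rfl⟩ <;> rcases hZ with hZ | ⟨b, rfl⟩
    · exact h.1 hY.1 hZ.1 hYZ
    · exact (hdis b Y (by simpa using hY)).symm
    · exact hdis a Z (by simpa using hZ)
    · exact hXd a b (fun hab => hYZ (by rw [hab]))
  · intro Y hY
    rcases mem_union.1 hY with hY | hY
    · exact h.2 Y (mem_sdiff.1 hY).1
    · obtain ⟨a, -, rfl⟩ := mem_image.1 hY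
      refine ⟨fun x hx => ?_, (hX a).2.1, (hX a).1⟩
      rcases (hX a).2.2 x hx with h1 | ⟨Z, hZ, hxZ⟩
      · exact (mem_sdiff.1 h1).1
      · exact (h.2 Z (hQ hZ)).1 hxZ
  · rw [card_union_of_disjoint, card_sdiff_of_subset hQ, card_image_of_injective _ hinj, card_univ,
      Fintype.card_fin]
    · have := card_le_card hQ
      omega
    · rw [disjoint_left]
      intro Y hY hY'
      obtain ⟨a, -, rfl⟩ := mem_image.1 hY'
      have h1 := hdis a _ hY
      rw [disjoint_self_iff_empty] at h1
      have h2 := (hX a).2.1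
      rw [h1, card_empty] at h2
      omega

lemma exists_injective_of_le_card {α : Type*} {m : ℕ} {S : Finset α} (h : m ≤ S.card) :
    ∃ f : Fin m → α, Function.Injective f ∧ ∀ i, f i ∈ S :=
  ⟨fun i => (S.equivFin.symm (Fin.castLE h i)).1, fun i j hij => by
    simpa [Subtype.coe_inj] using hij, fun i => (S.equivFin.symm (Fin.castLE h i)).2⟩

/-- Almost all vertices of `W` can be covered by disjoint `l`-paths of a fixed size. -/
lemma exists_tiling (k l t : ℕ) (hl1 : 1 ≤ l) (hl : 2 * l < k) {γ α : ℝ} (hγ : 0 < γ)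
    (hγ1 : γ ≤ 1) (hα : 0 < α) :
    ∃ N : ℕ, ∀ {V : Type*} [Fintype V] [DecidableEq V] (E : Finset (Finset V)) (W : Finset V),
      N ≤ Fintype.card V →
      (∀ S ⊆ W, S.card = k - 1 → (1 / (2 * ((k : ℝ) - l)) + γ) * Fintype.card V ≤
        ((linkVerts E S ∩ W).card : ℝ)) →
      ∃ 𝒯, IsTiling k l (2 * t * (k - l) + l) E W 𝒯 ∧
        ((W \ 𝒯.biUnion id).card : ℝ) ≤ α * Fintype.card V := by
  obtain ⟨G₁, N₁, h₁⟩ := exists_paths_of_dense_links k l t 1 hl1 hl (ε := γ / 4) (by positivity)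
    (by linarith)
  obtain ⟨G₂, N₂, h₂⟩ := exists_paths_of_dense_links k l t (t + 1) hl1 hl (ε := γ / 4)
    (by positivity) (by linarith)
  set s := 2 * t * (k - l) + l with hs
  have hs0 : 0 < s := by omega
  have hkl : (0 : ℝ) < (k : ℝ) - l := by
    have : (2 * l : ℝ) < k := by exact_mod_cast hl
    have : (0 : ℝ) ≤ l := Nat.cast_nonneg _
    linarith
  set M : ℝ := N₁ + N₂ + k + ((k - 1 : ℕ) : ℝ) ^ 2 / (γ / 4) with hM
  refine ⟨⌈M / α + G₁ / (γ / 4) + G₂ * s / (γ / 4)⌉₊, fun {V} _ _ E W hn hdeg => ?_⟩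
  set n : ℝ := (Fintype.card V : ℝ) with hnd
  have hn' : M / α + G₁ / (γ / 4) + G₂ * s / (γ / 4) ≤ n :=
    (Nat.le_ceil _).trans (Nat.cast_le.2 hn)
  have hp1 : 0 ≤ M / α := by positivity
  have hp2 : 0 ≤ G₁ / (γ / 4) := by positivity
  have hp3 : 0 ≤ G₂ * s / (γ / 4) := by positivity
  have hn1 : M ≤ α * n := by
    rw [← div_le_iff₀' hα]; linarith
  have hn2 : (G₁ : ℝ) ≤ γ / 4 * n := by
    rw [← div_le_iff₀' (by positivity)]; linarith
  have hn3 : (G₂ : ℝ) * s ≤ γ / 4 * n := by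
    rw [← div_le_iff₀' (by positivity)]; linarith
  classical
  obtain ⟨𝒯, h𝒯, hmax⟩ := exists_max_image
    ((univ : Finset (Finset (Finset V))).filter fun 𝒯 => IsTiling k l s E W 𝒯) card
    ⟨∅, mem_filter.2 ⟨mem_univ _, by simp [IsTiling]⟩⟩
  simp only [mem_filter, mem_univ, true_and] at h𝒯 hmax
  refine ⟨𝒯, h𝒯, ?_⟩
  by_contra! hu
  set U := W \ 𝒯.biUnion id with hU
  have hMu : M ≤ U.card := hn1.trans hu.le
  have hq0 : 0 ≤ ((k - 1 : ℕ) : ℝ) ^ 2 / (γ / 4) := by positivity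
  have hu1 : N₁ + N₂ + k ≤ U.card := by
    have : (N₁ + N₂ + k : ℝ) ≤ U.card := by linarith
    exact_mod_cast this
  have hu2 : ((k - 1 : ℕ) : ℝ) ^ 2 ≤ γ / 4 * U.card := by
    rw [← div_le_iff₀' (by positivity)]
    have : (0 : ℝ) ≤ N₁ + N₂ + k := by positivity
    linarith
  set D : ℝ := (1 / (2 * ((k : ℝ) - l)) + γ) * n with hD
  have hUW : U ⊆ W := sdiff_subset
  have hDn : D ≤ n := by
    obtain ⟨S, hSU, hS⟩ := exists_subset_card_eq (show k - 1 ≤ U.card by omega)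
    exact (hdeg S (hSU.trans hUW) hS).trans (Nat.cast_le.2 (card_le_univ _))
  have hdense := card_dense_ge (E := E) (U := U) (W := W) (r := k - 1) (ε := γ / 4) (D := D)
    (by positivity) (by positivity) hDn (by omega) hu2
    (fun S hS hSc => hdeg S (hS.trans hUW) hSc)
  set good := W.filter fun v => γ / 4 * (U.card : ℝ) ^ (k - 1) ≤ (linkTuples E (k - 1) U v).card
    with hgood
  have hgood' : ∀ v ∈ good, γ / 4 * (U.card : ℝ) ^ (k - 1) ≤ (linkTuples E (k - 1) U v).card :=
    fun v hv => (mem_filter.1 hv).2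
  rcases le_or_gt G₁ (good ∩ U).card with hA | hA
  · obtain ⟨g, hg, hgU⟩ := exists_injective_of_le_card hA
    obtain ⟨I, X, -, hX, hXd⟩ := h₁ E U (fun i _ => g i) (fun p q hpq => by
      have := hg hpq
      exact Prod.ext this (Subsingleton.elim _ _)) (by omega)
      fun i _ => hgood' _ (mem_inter.1 (hgU i)).1
    obtain ⟨𝒯', h1, h2⟩ := h𝒯.replace hs0 (empty_subset 𝒯) X (fun a => ⟨(hX a).1, (hX a).2.1,
      fun x hx => by
        rcases (hX a).2.2 x hx with h3 | ⟨i, -, b, rfl⟩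
        · exact .inl h3
        · exact .inl (mem_inter.1 (hgU i)).2⟩) hXd
    have := hmax 𝒯' h1
    rw [card_empty] at h2
    omega
  · set T := 𝒯.filter fun X => t + 1 ≤ (good ∩ X).card with hT
    have hcov : (good.card : ℝ) ≤ (good ∩ U).card + (T.card * s + 𝒯.card * t) := by
      have h1 : good ⊆ (good ∩ U) ∪ 𝒯.biUnion fun X => good ∩ X := by
        intro v hv
        by_cases hvU : v ∈ U
        · exact mem_union_left _ (mem_inter.2 ⟨hv, hvU⟩)
        · have hvW : v ∈ W := (mem_filter.1 hv).1
          rw [hU, mem_sdiff, not_and, not_not, mem_biUnion] at hvU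
          obtain ⟨X, hX, hvX⟩ := hvU hvW
          exact mem_union_right _ (mem_biUnion.2 ⟨X, hX, mem_inter.2 ⟨hv, hvX⟩⟩)
      have h2 : good.card ≤ (good ∩ U).card + (T.card * s + 𝒯.card * t) := by
        refine (card_le_card h1).trans ((card_union_le _ _).trans (Nat.add_le_add_left ?_ _))
        refine card_biUnion_le.trans ?_
        calc ∑ X ∈ 𝒯, (good ∩ X).card
            ≤ ∑ X ∈ 𝒯, ((if t + 1 ≤ (good ∩ X).card then s else 0) + t) := by
              refine sum_le_sum fun X hX => ?_
              have h3 : (good ∩ X).card ≤ s :=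
                (card_le_card inter_subset_right).trans (h𝒯.2 X hX).2.1.le
              split_ifs <;> omega
          _ = _ := by
              rw [sum_add_distrib, ← sum_filter, sum_const, sum_const, smul_eq_mul, smul_eq_mul]
      exact_mod_cast h2
    have hTn : (𝒯.card : ℝ) * t ≤ 1 / (2 * ((k : ℝ) - l)) * n := by
      have h1 : 𝒯.card * s ≤ Fintype.card V := by
        rw [← sum_const_nat fun X hX => (h𝒯.2 X hX).2.1]
        exact (card_biUnion h𝒯.1).symm.trans_le (card_le_univ _)
      have h2 : 𝒯.card * (2 * t * (k - l)) ≤ Fintype.card V :=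
        (Nat.mul_le_mul_left _ (by omega)).trans h1
      have h3 : (𝒯.card : ℝ) * (2 * t * ((k : ℝ) - l)) ≤ n := by
        have h4 := (Nat.cast_le (α := ℝ)).2 h2
        rwa [Nat.cast_mul, Nat.cast_mul, Nat.cast_mul, Nat.cast_sub (by omega : l ≤ k),
          Nat.cast_ofNat] at h4
      rw [one_div, ← div_eq_inv_mul, le_div_iff₀ (by positivity)]
      linarith
    have hT2 : G₂ ≤ T.card := by
      have h1 : ((good ∩ U).card : ℝ) ≤ G₁ := by exact_mod_cast hA.le
      have h2 : (G₂ : ℝ) * s ≤ T.card * s := by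
        rw [hD] at hdense
        linarith
      have h3 : (G₂ : ℝ) ≤ T.card := le_of_mul_le_mul_right h2 (by exact_mod_cast hs0)
      exact_mod_cast h3
    obtain ⟨e, he, heT⟩ := exists_injective_of_le_card hT2
    choose f hf hfm using fun i => exists_injective_of_le_card (mem_filter.1 (heT i)).2
    have heP : ∀ i, e i ∈ 𝒯 := fun i => (mem_filter.1 (heT i)).1
    obtain ⟨I, X, hI, hX, hXd⟩ := h₂ E U (fun i a => f i a) (fun ⟨i, a⟩ ⟨j, b⟩ hij => by
      have hij' : i = j := by
        by_contra hne
        refine disjoint_left.1 (h𝒯.1 (heP i) (heP j) (he.ne hne)) (mem_inter.1 (hfm i a)).2 ?_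
        have hij2 : f i a = f j b := hij
        rw [hij2]
        exact (mem_inter.1 (hfm j b)).2
      subst hij'
      exact Prod.ext rfl (hf i hij)) (by omega)
      fun i a => hgood' _ (mem_inter.1 (hfm i a)).1
    obtain ⟨𝒯', h3, h4⟩ := h𝒯.replace hs0 (𝒬 := I.image e)
      (fun Y hY => by obtain ⟨i, -, rfl⟩ := mem_image.1 hY; exact heP i) X
      (fun a => ⟨(hX a).1, (hX a).2.1, fun x hx => by
        rcases (hX a).2.2 x hx with h5 | ⟨i, hi, b, rfl⟩
        · exact .inl h5
        · exact .inr ⟨e i, mem_image_of_mem e hi, (mem_inter.1 (hfm i b)).2⟩⟩) hXd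
    have := hmax 𝒯' h3
    rw [card_image_of_injective _ he, hI] at h4
    omega

lemma Many.exists_finset {V : Type*} [Fintype V] [DecidableEq V] {d r : ℕ} {Q : Finset V → Prop}
    (h : Many d r Q) :
    ∃ s : Finset (Fin r → V), d ^ r ≤ s.card ∧ ∀ w ∈ s, Q (univ.image w) := by
  classical
  exact ⟨_, h.card_le, fun w hw => (mem_filter.1 hw).2⟩

open Classical in
/-- Distinct absorbers can be assigned to the parts of a partition of `R`. -/
lemma exists_assignment {V Ω : Type*} [DecidableEq V] [DecidableEq Ω] {j : ℕ}
    (good : Ω → Finset V → Prop) {ℱ : Finset Ω} :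
    ∀ (q : ℕ) (R : Finset V), R.card = q * j →
      (∀ T ⊆ R, T.card = j → q ≤ (ℱ.filter fun x => good x T).card) →
      ∃ τ : Ω → Finset V, (∀ x ∈ ℱ, τ x = ∅ ∨ good x (τ x)) ∧
        (∀ x y, x ≠ y → Disjoint (τ x) (τ y)) ∧ ℱ.biUnion τ = R ∧
        (ℱ.filter fun x => τ x ≠ ∅).card ≤ q ∧ ∀ x, τ x ⊆ R := by
  intro q
  induction q with
  | zero =>
    intro R hR _
    rw [zero_mul, card_eq_zero] at hR
    subst hR
    exact ⟨fun _ => ∅, by simp, by simp, by ext; simp, by simp, by simp⟩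
  | succ q ih =>
    intro R hR hgood
    obtain ⟨T, hTR, hT⟩ := exists_subset_card_eq (show j ≤ R.card by rw [hR, add_mul]; omega)
    obtain ⟨τ, h1, h2, h3, h4, h5⟩ := ih (R \ T)
      (by rw [card_sdiff_of_subset hTR, hR, hT, add_mul]; omega)
      fun S hS hSj => by
        have := hgood S (hS.trans sdiff_subset) hSj
        omega
    obtain ⟨x, hx, hxτ⟩ : ∃ x ∈ ℱ.filter fun x => good x T, x ∉ ℱ.filter fun x => τ x ≠ ∅ := by
      by_contra hcon
      have hsub : (ℱ.filter fun x => good x T) ⊆ ℱ.filter fun x => τ x ≠ ∅ :=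
        fun x hx => by_contra fun h => hcon ⟨x, hx, h⟩
      have := (hgood T hTR hT).trans (card_le_card hsub)
      omega
    rw [mem_filter] at hx
    have hτx : τ x = ∅ := by
      by_contra hne
      exact hxτ (mem_filter.2 ⟨hx.1, hne⟩)
    have hTd : ∀ y, Disjoint T (τ y) := fun y =>
      disjoint_of_subset_right (h5 y) disjoint_sdiff
    refine ⟨Function.update τ x T, ?_, ?_, ?_, ?_, ?_⟩
    · intro y hy
      by_cases hyx : y = x
      · subst hyx
        rw [Function.update_self]
        exact .inr hx.2
      · rw [Function.update_of_ne hyx]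
        exact h1 y hy
    · intro y z hyz
      by_cases hyx : y = x
      · subst hyx
        rw [Function.update_self, Function.update_of_ne hyz.symm]
        exact hTd z
      · rw [Function.update_of_ne hyx]
        by_cases hzx : z = x
        · subst hzx
          rw [Function.update_self]
          exact (hTd y).symm
        · rw [Function.update_of_ne hzx]
          exact h2 y z hyz
    · ext v
      rw [mem_biUnion]
      constructor
      · rintro ⟨y, hy, hv⟩
        by_cases hyx : y = x
        · subst hyx
          rw [Function.update_self] at hv
          exact hTR hv
        · rw [Function.update_of_ne hyx] at hv
          exact sdiff_subset (h5 y hv)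
      · intro hv
        by_cases hvT : v ∈ T
        · exact ⟨x, hx.1, by rwa [Function.update_self]⟩
        · have : v ∈ ℱ.biUnion τ := by rw [h3]; exact mem_sdiff.2 ⟨hv, hvT⟩
          obtain ⟨y, hy, hvy⟩ := mem_biUnion.1 this
          refine ⟨y, hy, ?_⟩
          have hyx : y ≠ x := by
            rintro rfl
            rw [hτx] at hvy
            exact absurd hvy (notMem_empty _)
          rwa [Function.update_of_ne hyx]
    · refine (card_le_card (t := insert x (ℱ.filter fun x => τ x ≠ ∅)) fun y hy => ?_).trans
        ((card_insert_le _ _).trans (by omega))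
      rw [mem_filter] at hy
      by_cases hyx : y = x
      · rw [hyx]; exact mem_insert_self _ _
      · rw [Function.update_of_ne hyx] at hy
        exact mem_insert_of_mem (mem_filter.2 hy)
    · intro y
      by_cases hyx : y = x
      · subst hyx
        rwa [Function.update_self]
      · rw [Function.update_of_ne hyx]
        exact (h5 y).trans sdiff_subset

open Classical in
/-- There is a short `l`-path that can absorb every small set of vertices of suitable size. -/
lemma exists_absorber (k l : ℕ) (hl1 : 1 ≤ l) (hl : 2 * l < k) {η β : ℝ} (hη : 0 < η)
    (hη1 : η ≤ 1) (hβ : 0 < β) :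
    ∃ θ > 0, ∃ N : ℕ, ∀ {V : Type*} [Fintype V] [DecidableEq V] (E : Finset (Finset V)),
      N ≤ Fintype.card V →
      (∀ S : Finset V, S.card = k - 1 → η * Fintype.card V ≤ ((linkVerts E S).card : ℝ)) →
      ∃ A B X, Spans k l E A B X ∧ (X.card : ℝ) ≤ β * Fintype.card V ∧
        ∀ R, Disjoint X R → (R.card : ℝ) ≤ θ * Fintype.card V → (k - l) ∣ R.card →
          Spans k l E A B (X ∪ R) := by
  obtain ⟨r, C, habs⟩ := exists_many_absorb k l hl1 hl
  set μ : ℝ := min β (η / 4) / (r + k) with hμd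
  have hk0 : (0 : ℝ) < k := by exact_mod_cast (by omega : 0 < k)
  have hμ : 0 < μ := by
    have : 0 < min β (η / 4) := lt_min hβ (by positivity)
    positivity
  have hμ' : (r + k) * μ = min β (η / 4) := by
    rw [hμd]; field_simp
  set ρ : ℝ := (η / 16) ^ r with hρd
  have hρ : 0 < ρ := by positivity
  have hρ1 : ρ ≤ 1 := pow_le_one₀ (by positivity) (by linarith)
  obtain ⟨N₁, hN₁⟩ := exists_pow_le_exp (k - l) (δ := ρ * μ / 8) (by positivity)
  refine ⟨ρ * μ / 8, by positivity, N₁ + k + ⌈2 / μ⌉₊ + ⌈(2 * C + 4) / η⌉₊,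
    fun {V} _ _ E hN hdeg => ?_⟩
  set n : ℝ := (Fintype.card V : ℝ) with hnd
  have hn0 : 0 ≤ n := Nat.cast_nonneg _
  have hn1 : 2 ≤ μ * n := by
    rw [← div_le_iff₀' hμ]
    exact (Nat.le_ceil _).trans (Nat.cast_le.2 (by omega))
  have hn2 : 2 * C + 4 ≤ η * n := by
    rw [← div_le_iff₀' hη]
    exact (Nat.le_ceil _).trans (Nat.cast_le.2 (by omega))
  have hkn : k ≤ Fintype.card V := by omega
  set D := ⌈η * n⌉₊ with hD
  set d := ⌈η * n / 4⌉₊ with hd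
  set c := ⌊η * n / 4⌋₊ with hc
  set m := ⌊μ * n⌋₊ with hm
  have hDV : D ≤ Fintype.card V := Nat.ceil_le.2 (by rw [← hnd]; nlinarith)
  have hD1 : η * n ≤ D := Nat.le_ceil _
  have hdc : d + c + C ≤ D := by
    have h1 : (d : ℝ) < η * n / 4 + 1 := Nat.ceil_lt_add_one (by positivity)
    have h2 : (c : ℝ) ≤ η * n / 4 := Nat.floor_le (by positivity)
    have : ((d + c + C : ℕ) : ℝ) ≤ D := by push_cast; linarith
    exact_mod_cast this
  have hm1 : (m : ℝ) ≤ μ * n := Nat.floor_le (by positivity)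
  have hm2 : μ * n / 2 ≤ m := by
    have := Nat.lt_floor_add_one (μ * n)
    linarith
  have hrkm : ((r + k) * m : ℝ) ≤ min β (η / 4) * n := by
    rw [← hμ', mul_assoc]
    gcongr
  have hrm : (∅ : Finset V).card + r * m ≤ c := by
    rw [card_empty, zero_add]
    refine Nat.le_floor ?_
    push_cast
    have h1 : min β (η / 4) * n ≤ η / 4 * n := by gcongr; exact min_le_right _ _
    have h2 : (0 : ℝ) ≤ k * m := by positivity
    linarith
  have hdegN : ∀ S : Finset V, S.card = k - 1 → D ≤ (linkVerts E S).card :=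
    fun S hS => Nat.ceil_le.2 (hdeg S hS)
  let Ω := (Fin r → V) × Finset (Fin r) × Finset (Fin r)
  have : Nonempty V := Fintype.card_pos_iff.1 (by omega)
  let supp : Ω → Finset V := fun x => univ.image x.1
  let a : Ω → Finset V := fun x => x.2.1.image x.1
  let b : Ω → Finset V := fun x => x.2.2.image x.1
  let good : Ω → Finset V → Prop := fun x T => Disjoint (supp x) T ∧
    Spans k l E (a x) (b x) (supp x) ∧ Spans k l E (a x) (b x) (supp x ∪ T)
  obtain ⟨ℱ, hℱm, hℱd, hℱ, hℱT⟩ := exists_selection (powersetCard (k - l) (univ : Finset V)) good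
    supp (r := r) (c := c) (m := m) hρ hρ1 ∅
    (fun x => by simpa using (card_image_le : (univ.image x.1).card ≤ _))
    (fun x T hx => by
      have h1 := hx.2.1.card_left
      exact (card_pos.1 (by omega)).mono hx.2.1.left_subset)
    (fun F hF T hT => by
      rw [mem_powersetCard] at hT
      obtain ⟨ws, h1, hws⟩ :=
        (habs hDV hdegN T F hT.2 (by omega : d + F.card + C ≤ D)).exists_finset
      have h2 : (d ^ r : ℕ) ≤ (univ.filter fun x => good x T ∧ Disjoint (supp x) F).card := by
        refine h1.trans ((card_le_card fun w hw => ?_).trans (card_image_le (f := Prod.fst)))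
        obtain ⟨hwT, A, B, hA, hB, -, hS, hST⟩ := hws w hw
        obtain ⟨I, hI, hIA⟩ := subset_image_iff.1 hA
        obtain ⟨J, hJ, hJB⟩ := subset_image_iff.1 hB
        rw [disjoint_union_right] at hwT
        rw [← hIA, ← hJB] at hS hST
        refine mem_image.2 ⟨(w, I, J), mem_filter.2 ⟨mem_univ _, ⟨hwT.1, hS, hST⟩, hwT.2⟩, rfl⟩
      have h3 : (Fintype.card Ω : ℝ) = n ^ r * 4 ^ r := by
        simp only [Ω, Fintype.card_prod, Fintype.card_fun, Fintype.card_finset, Fintype.card_fin]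
        push_cast
        rw [← mul_pow]
        norm_num
        rfl
      calc ρ * Fintype.card Ω = (η * n / 4) ^ r := by
            rw [h3, hρd, ← mul_pow, ← mul_pow]; congr 1; ring
        _ ≤ (d : ℝ) ^ r := by gcongr; exact Nat.le_ceil _
        _ ≤ _ := by
          rw [← Nat.cast_pow, Nat.cast_le]
          convert h2)
    hrm
    (by
      rw [card_powersetCard, card_univ]
      calc ((Fintype.card V).choose (k - l) : ℝ) ≤ n ^ (k - l) := by
            rw [hnd]; exact_mod_cast Nat.choose_le_pow _ _
        _ ≤ Real.exp (ρ * μ / 8 * n) := hN₁ _ (by omega)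
        _ ≤ _ := by
          rw [Real.exp_le_exp]
          nlinarith)
  have hℱS : ∀ x ∈ ℱ, Spans k l E (a x) (b x) (supp x) := fun x hx => by
    obtain ⟨-, T, -, hT⟩ := hℱ x hx
    exact hT.2.1
  have hℱne : ℱ.Nonempty := by
    obtain ⟨T, -, hT⟩ := exists_subset_card_eq (show k - l ≤ (univ : Finset V).card by
      rw [card_univ]; omega)
    have h1 := hℱT T (mem_powersetCard.2 ⟨subset_univ _, hT⟩)
    have h2 : (0 : ℝ) < m := by linarith
    have h3 : 0 < ρ * m / 4 := by positivity
    obtain ⟨x, hx⟩ := card_pos.1 (Nat.cast_pos.1 (h3.trans_le h1))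
    simp only [mem_filter] at hx
    exact ⟨x, hx.1⟩
  have hsuppc : (ℱ.biUnion supp).card ≤ r * m := by
    refine (card_biUnion_le_card_mul ℱ supp r fun x _ => ?_).trans ?_
    · simpa using (card_image_le : (univ.image x.1).card ≤ _)
    · rw [mul_comm]; gcongr
  have hFD : (ℱ.biUnion supp ∩ univ).card + k * ℱ.card ≤ D := by
    rw [inter_univ]
    have h1 : (ℱ.biUnion supp).card + k * ℱ.card ≤ (r + k) * m := by
      rw [add_mul]; gcongr
    refine h1.trans ?_
    have h2 : min β (η / 4) * n ≤ η / 4 * n := by gcongr; exact min_le_right _ _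
    have : (((r + k) * m : ℕ) : ℝ) ≤ D := by
      push_cast
      have : 0 ≤ η * n := by positivity
      linarith
    exact_mod_cast this
  obtain ⟨i₀, -, i₁, -, K, -, hKF, hKc, hK⟩ := exists_link (E := E) (D := D) (W := univ) hl
    (by rw [card_univ]; exact hDV) (fun S hS => by rw [inter_univ]; exact hdegN S hS) a b
    (ℱ.biUnion supp) hℱne (fun x hx => (hℱS x hx).card_left) (fun x hx => (hℱS x hx).card_right)
    (fun x hx y hy hxy => disjoint_of_subset_left (hℱS x hx).right_subset
      (disjoint_of_subset_right (hℱS y hy).left_subset (hℱd hx hy hxy))) hFD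
  have hKs : ∀ x ∈ ℱ, Disjoint (supp x) K := fun x hx =>
    (disjoint_of_subset_right (subset_biUnion_of_mem supp hx) hKF).symm
  refine ⟨a i₀, b i₁, K ∪ ℱ.biUnion supp, hK supp hℱS hℱd hKs, ?_, fun R hXR hRc hRd => ?_⟩
  · have h1 : (K ∪ ℱ.biUnion supp).card ≤ (r + k) * m := by
      refine (card_union_le _ _).trans ?_
      have : k * ℱ.card ≤ k * m := by gcongr
      rw [add_mul]; omega
    have h2 : min β (η / 4) * n ≤ β * n := by gcongr; exact min_le_left _ _
    calc ((K ∪ ℱ.biUnion supp).card : ℝ) ≤ (((r + k) * m : ℕ) : ℝ) := Nat.cast_le.2 h1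
      _ ≤ _ := by push_cast; linarith
  · obtain ⟨q, hq⟩ := hRd
    have hqR : (q : ℝ) ≤ R.card := by
      rw [hq]
      exact Nat.cast_le.2 (Nat.le_mul_of_pos_left _ (by omega))
    obtain ⟨τ, h1, h2, h3, -, h5⟩ := exists_assignment good (ℱ := ℱ) q R (by rw [hq, mul_comm])
      fun T _ hT => by
        have h6 := hℱT T (mem_powersetCard.2 ⟨subset_univ _, hT⟩)
        have h7 : ρ * (μ * n / 2) ≤ ρ * m := by gcongr
        have h8 : (q : ℝ) ≤ ρ * m / 4 := by linarith
        exact Nat.cast_le.1 (h8.trans h6)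
    rw [disjoint_union_left, disjoint_biUnion_left] at hXR
    have h6 := hK (fun x => supp x ∪ τ x) (fun x hx => ?_) (fun x hx y hy hxy => ?_)
      (fun x hx => ?_)
    · convert h6 using 1
      rw [union_assoc, ← h3]
      congr 1
      ext v
      simp only [mem_union, mem_biUnion]
      grind
    · rcases h1 x hx with h | h
      · simpa [h] using hℱS x hx
      · exact h.2.2
    · have e1 : Disjoint (supp x) (supp y) := hℱd hx hy hxy
      have e2 : Disjoint (supp x) (τ y) := disjoint_of_subset_right (h5 y) (hXR.2 x hx)
      have e3 : Disjoint (τ x) (supp y) := (disjoint_of_subset_right (h5 x) (hXR.2 y hy)).symm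
      have e4 := h2 x y hxy
      simp only [Function.onFun, disjoint_union_left, disjoint_union_right]
      exact ⟨⟨e1, e3⟩, e2, e4⟩
    · rw [disjoint_union_left]
      exact ⟨hKs x hx, (disjoint_of_subset_right (h5 x) hXR.1).symm⟩

open Classical in
/-- There is a small set of vertices `W` avoiding `F₀` in which every `(k - 1)`-set has many
neighbours. -/
lemma exists_reservoir (k : ℕ) {η β : ℝ} (hη : 0 < η) (hη1 : η ≤ 1) (hβ : 0 < β) :
    ∃ κ > 0, ∃ N : ℕ, ∀ {V : Type*} [Fintype V] [DecidableEq V] (E : Finset (Finset V)),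
      N ≤ Fintype.card V →
      (∀ S : Finset V, S.card = k - 1 → η * Fintype.card V ≤ ((linkVerts E S).card : ℝ)) →
      ∀ F : Finset V, (F.card : ℝ) ≤ η / 4 * Fintype.card V →
      ∃ W : Finset V, Disjoint W F ∧ (W.card : ℝ) ≤ β * Fintype.card V ∧
        ∀ S : Finset V, S.card = k - 1 →
          κ * Fintype.card V ≤ ((linkVerts E S ∩ W).card : ℝ) := by
  set μ := min β (η / 4) with hμd
  have hμ : 0 < μ := lt_min hβ (by positivity)
  obtain ⟨N₁, hN₁⟩ := exists_pow_le_exp (k - 1) (δ := η / 2 * μ / 8) (by positivity)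
  refine ⟨η / 2 * μ / 8, by positivity, N₁ + 1 + ⌈2 / μ⌉₊, fun {V} _ _ E hN hdeg F₀ hF₀ => ?_⟩
  set n : ℝ := (Fintype.card V : ℝ) with hnd
  have hn0 : 0 ≤ n := Nat.cast_nonneg _
  have hn1 : 2 ≤ μ * n := by
    rw [← div_le_iff₀' hμ]
    exact (Nat.le_ceil _).trans (Nat.cast_le.2 (by omega))
  set c := ⌊η / 2 * n⌋₊ with hc
  set m := ⌊μ * n⌋₊ with hm
  have hm1 : (m : ℝ) ≤ μ * n := Nat.floor_le (by positivity)
  have hm2 : μ * n / 2 ≤ m := by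
    have := Nat.lt_floor_add_one (μ * n)
    linarith
  have hc1 : (c : ℝ) ≤ η / 2 * n := Nat.floor_le (by positivity)
  have : Nonempty V := Fintype.card_pos_iff.1 (by omega)
  obtain ⟨W, hWm, -, hW, hWS⟩ := exists_selection (powersetCard (k - 1) (univ : Finset V))
    (fun v S => v ∈ linkVerts E S) (fun v : V => ({v} : Finset V)) (r := 1) (c := c) (m := m)
    (ρ := η / 2) (by positivity) (by linarith) F₀ (fun v => by simp) (fun v S _ => by simp)
    (fun F hF S hS => by
      rw [mem_powersetCard] at hS
      have h1 := hdeg S hS.2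
      have h2 : (linkVerts E S).card ≤
          (univ.filter fun v => v ∈ linkVerts E S ∧ Disjoint ({v} : Finset V) F).card + F.card := by
        refine (card_le_card fun v hv => ?_).trans (card_union_le _ _)
        by_cases hvF : v ∈ F
        · exact mem_union_right _ hvF
        · exact mem_union_left _ (mem_filter.2 ⟨mem_univ _, hv, by simpa using hvF⟩)
      have h3 : ((linkVerts E S).card : ℝ) ≤
          ((univ.filter fun v => v ∈ linkVerts E S ∧ Disjoint ({v} : Finset V) F).card : ℝ)
            + F.card := by exact_mod_cast h2
      have h4 : (F.card : ℝ) ≤ c := Nat.cast_le.2 hF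
      rw [← hnd]
      have h5 : η / 2 * n ≤
          ((univ.filter fun v => v ∈ linkVerts E S ∧ Disjoint ({v} : Finset V) F).card : ℝ) := by
        linarith
      convert h5)
    (by
      rw [one_mul]
      refine Nat.le_floor ?_
      have h1 : μ * n ≤ η / 4 * n := by gcongr; exact min_le_right _ _
      push_cast
      linarith)
    (by
      rw [card_powersetCard, card_univ]
      calc ((Fintype.card V).choose (k - 1) : ℝ) ≤ n ^ (k - 1) := by
            rw [hnd]; exact_mod_cast Nat.choose_le_pow _ _
        _ ≤ Real.exp (η / 2 * μ / 8 * n) := hN₁ _ (by omega)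
        _ ≤ _ := by
          rw [Real.exp_le_exp]
          nlinarith)
  refine ⟨W, ?_, ?_, fun S hS => ?_⟩
  · rw [disjoint_left]
    intro v hv
    simpa using (hW v hv).1
  · have h1 : μ * n ≤ β * n := by gcongr; exact min_le_left _ _
    exact (Nat.cast_le.2 hWm).trans (hm1.trans h1)
  · have h1 := hWS S (mem_powersetCard.2 ⟨subset_univ _, hS⟩)
    have h2 : η / 2 * (μ * n / 2) ≤ η / 2 * m := by gcongr
    have h3 : η / 2 * μ / 8 * n ≤ η / 2 * m / 4 := by linarith
    refine (h3.trans h1).trans (Nat.cast_le.2 (card_le_card fun v hv => ?_))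
    simp only [mem_filter] at hv
    exact mem_inter.2 ⟨hv.2, hv.1⟩

lemma Spans.disjoint {V : Type*} [DecidableEq V] {k l : ℕ} {E : Finset (Finset V)}
    {A B X : Finset V} (h : Spans k l E A B X) (hX : l < X.card) : Disjoint A B := by
  cases h with
  | base _ hA => omega
  | step h _ _ _ hd _ =>
    exact disjoint_of_subset_left subset_union_left (disjoint_of_subset_right h.right_subset hd)

lemma degH_le_card_linkVerts {n k : ℕ} {E : Finset (Finset (Fin n))} (hE : ∀ e ∈ E, e.card = k)
    (hk : 1 ≤ k) {S : Finset (Fin n)} (hS : S.card = k - 1) :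
    degH E S ≤ (linkVerts E S).card := by
  refine (card_le_card (t := (linkVerts E S).image fun v => insert v S) fun e he => ?_).trans
    card_image_le
  rw [mem_filter] at he
  obtain ⟨v, hv, rfl⟩ := exists_eq_insert_iff.2
    ⟨he.2, show S.card + 1 = e.card by rw [hE e he.1]; omega⟩
  exact mem_image.2 ⟨v, mem_linkVerts.2 ⟨hv, he.1⟩, rfl⟩

theorem stmt14 (k l : ℕ) (hk : 3 ≤ k) (hl1 : 1 ≤ l) (hl2 : 2 * l < k)
    (γ : ℝ) (hγ : 0 < γ) :
    ∃ n₀ : ℕ, ∀ n : ℕ, n₀ ≤ n → (k - l) ∣ n →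
      ∀ E : Finset (Finset (Fin n)), (∀ e ∈ E, e.card = k) →
        (∀ S : Finset (Fin n), S.card = k - 1 →
          (1 / (2 * ((k : ℝ) - l)) + γ) * n ≤ (degH E S : ℝ)) →
        HasHamCycle k l E := by
  set δ := min γ 1 with hδd
  have hδ : 0 < δ := lt_min hγ one_pos
  have hδ1 : δ ≤ 1 := min_le_right _ _
  obtain ⟨θ, hθ, N₁, habs⟩ := exists_absorber k l hl1 hl2 hδ hδ1 (β := δ / 4) (by positivity)
  obtain ⟨κ, hκ, N₂, hres⟩ := exists_reservoir k hδ hδ1 (β := min (θ / 2) (δ / 4))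
    (lt_min (by positivity) (by positivity))
  set t := ⌈2 * k / κ⌉₊ + 1 with ht
  obtain ⟨N₃, htil⟩ := exists_tiling k l t hl1 hl2 (γ := δ / 2) (α := min (θ / 2) (1 / 4))
    (by positivity) (by linarith) (lt_min (by positivity) (by norm_num))
  refine ⟨N₁ + N₂ + N₃ + k + ⌈2 * k / κ⌉₊, fun n hn hdvd E hE hdegE => ?_⟩
  have hkl : (0 : ℝ) < (k : ℝ) - l := by
    have : (2 * l : ℝ) < k := by exact_mod_cast hl2
    have : (0 : ℝ) ≤ l := Nat.cast_nonneg _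
    linarith
  have hnpos : (0 : ℝ) < n := by exact_mod_cast (by omega : 0 < n)
  have hdeg : ∀ S : Finset (Fin n), S.card = k - 1 →
      (1 / (2 * ((k : ℝ) - l)) + δ) * n ≤ ((linkVerts E S).card : ℝ) := by
    intro S hS
    refine le_trans ?_ ((hdegE S hS).trans
      (Nat.cast_le.2 (degH_le_card_linkVerts hE (by omega) hS)))
    gcongr
    exact min_le_left _ _
  have hdegδ : ∀ S : Finset (Fin n), S.card = k - 1 →
      δ * Fintype.card (Fin n) ≤ ((linkVerts E S).card : ℝ) := by
    intro S hS
    rw [Fintype.card_fin]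
    have h1 : 0 ≤ 1 / (2 * ((k : ℝ) - l)) * n := by positivity
    linarith [hdeg S hS]
  obtain ⟨A, B, P, hP, hPc, hPabs⟩ := habs E (by rw [Fintype.card_fin]; omega) hdegδ
  obtain ⟨W, hWP, hWc, hW⟩ := hres E (by rw [Fintype.card_fin]; omega) hdegδ P hPc
  rw [Fintype.card_fin] at hPc hWc
  simp only [Fintype.card_fin] at hPabs hW
  have hWθ : (W.card : ℝ) ≤ θ / 2 * n := hWc.trans (by gcongr; exact min_le_left _ _)
  have hWδ : (W.card : ℝ) ≤ δ / 4 * n := hWc.trans (by gcongr; exact min_le_right _ _)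
  have hPW : ((P ∪ W).card : ℝ) ≤ δ / 2 * n := by
    have : ((P ∪ W).card : ℝ) ≤ P.card + W.card := by exact_mod_cast card_union_le P W
    linarith
  obtain ⟨𝒯, h𝒯, hcov⟩ := htil E (P ∪ W)ᶜ (by rw [Fintype.card_fin]; omega) (fun S _ hS => by
    rw [Fintype.card_fin]
    have h1 : (linkVerts E S).card ≤ (linkVerts E S ∩ (P ∪ W)ᶜ).card + (P ∪ W).card := by
      refine (card_le_card fun v hv => ?_).trans (card_union_le _ _)
      by_cases hvF : v ∈ P ∪ W
      · exact mem_union_right _ hvF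
      · exact mem_union_left _ (mem_inter.2 ⟨hv, mem_compl.2 hvF⟩)
    have h2 : ((linkVerts E S).card : ℝ) ≤ (linkVerts E S ∩ (P ∪ W)ᶜ).card + (P ∪ W).card := by
      exact_mod_cast h1
    linarith [hdeg S hS])
  rw [Fintype.card_fin] at hcov
  set s := 2 * t * (k - l) + l with hs
  have ht1 : 1 ≤ t := by omega
  have hst : t + l ≤ s := by
    have : t * 1 ≤ 2 * t * (k - l) := by
      rw [mul_comm 2 t, mul_assoc]
      exact Nat.mul_le_mul_left _ (by omega)
    omega
  have h𝒯ne : 𝒯.Nonempty := by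
    rw [nonempty_iff_ne_empty]
    rintro rfl
    rw [biUnion_empty, sdiff_empty] at hcov
    have h1 : (((P ∪ W)ᶜ.card : ℕ) : ℝ) + (P ∪ W).card = n := by
      have := card_compl_add_card (P ∪ W)
      rw [Fintype.card_fin] at this
      exact_mod_cast this
    have h2 : min (θ / 2) (1 / 4) * n ≤ 1 / 4 * n := by gcongr; exact min_le_right _ _
    have h3 : δ / 2 * n ≤ 1 / 2 * n := by gcongr
    linarith
  have h𝒯c : 𝒯.card * t ≤ n := by
    have h1 : 𝒯.card * s ≤ n := by
      rw [← sum_const_nat fun X hX => (h𝒯.2 X hX).2.1]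
      exact (card_biUnion h𝒯.1).symm.trans_le ((card_le_univ _).trans (Fintype.card_fin n).le)
    exact (Nat.mul_le_mul_left _ (by omega)).trans h1
  set D := ⌈κ * n⌉₊ with hD
  have hDW : ∀ S : Finset (Fin n), S.card = k - 1 → D ≤ (linkVerts E S ∩ W).card :=
    fun S hS => Nat.ceil_le.2 (hW S hS)
  have hDW' : D ≤ W.card := by
    obtain ⟨S, -, hS⟩ := exists_subset_card_eq (show k - 1 ≤ (univ : Finset (Fin n)).card by
      rw [card_univ, Fintype.card_fin]; omega)
    exact (hDW S hS).trans (card_le_card inter_subset_right)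
  have hkD : k * (𝒯.card + 1) ≤ D := by
    have h1 : (k : ℝ) * 𝒯.card ≤ κ / 2 * n := by
      have h2 : 2 * k / κ ≤ t := by
        rw [ht]; push_cast
        linarith [Nat.le_ceil (2 * k / κ)]
      rw [div_le_iff₀ hκ] at h2
      have h3 : (𝒯.card : ℝ) * t ≤ n := by exact_mod_cast h𝒯c
      have h4 : (2 * k : ℝ) * 𝒯.card ≤ t * κ * 𝒯.card := by gcongr
      nlinarith
    have h5 : (k : ℝ) ≤ κ / 2 * n := by
      have h6 : 2 * k / κ ≤ n := (Nat.le_ceil _).trans (Nat.cast_le.2 (by omega))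
      rw [div_le_iff₀ hκ] at h6
      linarith
    have h7 : ((k * (𝒯.card + 1) : ℕ) : ℝ) ≤ D := by
      push_cast
      linarith [Nat.le_ceil (κ * n)]
    exact_mod_cast h7
  have hTP : ∀ X ∈ 𝒯, Disjoint X P ∧ Disjoint X W := fun X hX => by
    rw [← disjoint_union_right]
    exact disjoint_of_subset_left (h𝒯.2 X hX).1 disjoint_compl_left
  have hPpos : P.Nonempty := by
    have h1 := hP.card_left
    exact (card_pos.1 (by omega)).mono hP.left_subset
  have hPT : P ∉ 𝒯 := fun h => hPpos.ne_empty (disjoint_self_iff_empty _ |>.1 (hTP P h).1)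
  set ι := insert P 𝒯 with hι
  have hιc : ι.card = 𝒯.card + 1 := card_insert_of_notMem hPT
  have hends : ∀ X, ∃ a b, X ∈ ι → Spans k l E a b X ∧ (X = P → a = A ∧ b = B) := by
    intro X
    by_cases hX : X = P
    · subst hX
      exact ⟨A, B, fun _ => ⟨hP, fun _ => ⟨rfl, rfl⟩⟩⟩
    · by_cases hX' : X ∈ 𝒯
      · obtain ⟨a, b, hab⟩ := (h𝒯.2 X hX').2.2
        exact ⟨a, b, fun _ => ⟨hab, fun h => absurd h hX⟩⟩
      · exact ⟨∅, ∅, fun h => ((mem_insert.1 h).elim hX hX').elim⟩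
  choose a b hab using hends
  have hιd : (ι : Set (Finset (Fin n))).PairwiseDisjoint id := by
    rw [hι, coe_insert]
    refine h𝒯.1.insert fun X hX _ => (hTP X hX).1.symm
  have hιW : ι.biUnion id ∩ W = ∅ := by
    rw [← disjoint_iff_inter_eq_empty, disjoint_biUnion_left]
    intro X hX
    rcases mem_insert.1 hX with rfl | hX
    · exact hWP.symm
    · exact (hTP X hX).2
  obtain ⟨i₀, -, i₁, -, K, hKW, hKF, hKc, hK⟩ := exists_link (E := E) (D := D) (W := W) hl2 hDW' hDW
    a b (ι.biUnion id) (s := ι) ⟨P, mem_insert_self _ _⟩ (fun X hX => (hab X hX).1.card_left)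
    (fun X hX => (hab X hX).1.card_right)
    (fun X hX Y hY hXY => disjoint_of_subset_left (hab X hX).1.right_subset
      (disjoint_of_subset_right (hab Y hY).1.left_subset (hιd hX hY hXY)))
    (by rw [hιW, card_empty, hιc]; omega)
  have hKι : ∀ X ∈ ι, Disjoint X K := fun X hX =>
    (disjoint_of_subset_right (subset_biUnion_of_mem id hX) hKF).symm
  have hQ := hK id (fun X hX => (hab X hX).1) hιd hKι
  set Q := K ∪ ι.biUnion id with hQd
  have hQl : l < Q.card := by
    obtain ⟨X, hX⟩ := h𝒯ne
    have h1 : X ⊆ Q := (subset_biUnion_of_mem id (mem_insert_of_mem hX)).trans subset_union_right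
    have h2 := card_le_card h1
    rw [(h𝒯.2 X hX).2.1] at h2
    omega
  have hdis := hQ.disjoint hQl
  have hQW : Q ∩ W = K := by
    rw [hQd, union_inter_distrib_right, hιW, union_empty, inter_eq_left]
    exact hKW
  obtain ⟨Z, hZc, hZW, hZd, hZE⟩ := exists_extend_within (E := E) hDW' hDW (k - 2 * l)
    (b i₁ ∪ a i₀) Q
    (by rw [card_union_of_disjoint hdis.symm, hQ.card_left, hQ.card_right]; omega) (by omega)
    (by rw [hQW]; rw [hιc] at hKc; omega)
  rw [disjoint_union_right] at hZd
  set R := (Q ∪ Z)ᶜ with hR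
  have hRQ : Disjoint Q R := disjoint_of_subset_left subset_union_left disjoint_compl_right
  have hRZ : Disjoint Z R := disjoint_of_subset_left subset_union_right disjoint_compl_right
  have hιR : ∀ X ∈ ι, Disjoint X R := fun X hX =>
    disjoint_of_subset_left ((subset_biUnion_of_mem id hX).trans subset_union_right) hRQ
  have hKR : Disjoint K R := disjoint_of_subset_left subset_union_left hRQ
  have hRc : (R.card : ℝ) ≤ θ * n := by
    have h1 : R ⊆ W ∪ ((P ∪ W)ᶜ \ 𝒯.biUnion id) := by
      intro v hv
      rw [mem_union, mem_sdiff, mem_compl, mem_union, mem_biUnion]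
      by_cases hvW : v ∈ W
      · exact .inl hvW
      · refine .inr ⟨?_, ?_⟩
        · rintro (h | h)
          · exact disjoint_left.1 (hιR P (mem_insert_self _ _)) h hv
          · exact hvW h
        · rintro ⟨X, hX, hvX⟩
          exact disjoint_left.1 (hιR X (mem_insert_of_mem hX)) hvX hv
    have h2 : (R.card : ℝ) ≤ W.card + ((P ∪ W)ᶜ \ 𝒯.biUnion id).card := by
      exact_mod_cast (card_le_card h1).trans (card_union_le _ _)
    have h3 : min (θ / 2) (1 / 4) * n ≤ θ / 2 * n := by gcongr; exact min_le_left _ _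
    linarith
  have hRd : (k - l) ∣ R.card := by
    obtain ⟨m, hm⟩ := hQ.card_eq hl2
    have h1 := card_compl_add_card (Q ∪ Z)
    rw [card_union_of_disjoint hZd.2.symm, hm, hZc, Fintype.card_fin, ← hR] at h1
    have h2 : R.card + (m + 1) * (k - l) = n := by
      rw [add_mul, one_mul]; omega
    exact (Nat.dvd_add_left (Dvd.intro_left _ rfl)).1 (h2 ▸ hdvd)
  have hfin := hK (fun X => if X = P then P ∪ R else X) (fun X hX => ?_) (fun X hX Y hY hXY => ?_)
    (fun X hX => ?_)
  · have hun : K ∪ ι.biUnion (fun X => if X = P then P ∪ R else X) = Q ∪ R := by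
      rw [hι, biUnion_insert, if_pos rfl, hQd, hι, biUnion_insert]
      have : 𝒯.biUnion (fun X => if X = P then P ∪ R else X) = 𝒯.biUnion id :=
        biUnion_congr rfl fun X hX => if_neg (by rintro rfl; exact hPT hX)
      rw [this, id]
      ac_rfl
    rw [hun] at hfin
    refine hfin.hasHamCycle hl2 hZc (hQl.trans_le (card_le_card subset_union_left)) ?_ ?_ ?_
    · rw [disjoint_union_left]
      exact ⟨hZd.2.symm, hRZ.symm⟩
    · rw [union_right_comm, hR, union_compl]
    · rwa [union_right_comm]
  · by_cases hXP : X = P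
    · subst hXP
      rw [if_pos rfl]
      have h1 := (hab X hX).2 rfl
      rw [h1.1, h1.2]
      exact hPabs R (hιR X hX) hRc hRd
    · rw [if_neg hXP]
      exact (hab X hX).1
  · have h1 : Disjoint X Y := hιd hX hY hXY
    have h2 := hιR X hX
    have h3 := hιR Y hY
    simp only [Function.onFun]
    split_ifs with h4 h5 h5
    · exact absurd (h4.trans h5.symm) hXY
    · subst h4
      exact disjoint_union_left.2 ⟨h1, h3.symm⟩
    · subst h5
      exact disjoint_union_right.2 ⟨h1, h2⟩
    · exact h1
  · split_ifs with h4
    · subst h4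
      exact disjoint_union_left.2 ⟨hKι X hX, hKR.symm⟩
    · exact hKι X hX
end

section
/- For all integers k ≥ 2 and t₀ ≥ 1 and every ε > 0 there exists T₀ = T₀(k,t₀,ε) such that every sufficiently large k-uniform hypergraph H = (V,E) on n vertices admits a partition V = V₀ ∪ V₁ ∪ ⋯ ∪ V_t such that (i) t₀ ≤ t ≤ T₀, (ii) |V₁| = ⋯ = |V_t| and |V₀| ≤ εn, and (iii) for all but at most ε·C(t,k) of the k-element subsets {i₁,…,i_k} ⊆ [t], the k-tuple (V_{i₁},…,V_{i_k}) is ε-regular. -/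
open Finset
open scoped Classical

/-- Number of edges of `E` having exactly one vertex in each class of the tuple `W`. -/
def eHyp {n k : ℕ} (E : Finset (Finset (Fin n))) (W : Fin k → Finset (Fin n)) : ℕ :=
  (E.filter fun e => ∀ i, (e ∩ W i).card = 1).card

/-- Density of `E` with respect to the tuple `W`. -/
noncomputable def densHyp {n k : ℕ} (E : Finset (Finset (Fin n)))
    (W : Fin k → Finset (Fin n)) : ℝ :=
  (eHyp E W : ℝ) / ∏ i, ((W i).card : ℝ)

/-- The tuple `W` is `(ε,d)`-regular w.r.t. the hypergraph `E`. -/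
def RegularTuple {n k : ℕ} (ε d : ℝ) (E : Finset (Finset (Fin n)))
    (W : Fin k → Finset (Fin n)) : Prop :=
  ∀ A : Fin k → Finset (Fin n), (∀ i, A i ⊆ W i) →
    (∀ i, ε * ((W i).card : ℝ) ≤ ((A i).card : ℝ)) →
    |densHyp E A - d| ≤ ε

/-- The tuple `W` is `ε`-regular w.r.t. `E`: `(ε,d)`-regular for some `d > 0`. -/
def EpsRegular {n k : ℕ} (ε : ℝ) (E : Finset (Finset (Fin n)))
    (W : Fin k → Finset (Fin n)) : Prop :=
  ∃ d : ℝ, 0 < d ∧ RegularTuple ε d E W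

/-! ### Averages over the fibres of a map, and their energy -/

/-- The average of `f` over the fibre of `C` through `x`. -/
noncomputable def fiberAvg {X K : Type*} [Fintype X] (C : X → K) (f : X → ℝ) (x : X) : ℝ :=
  (∑ y with C y = C x, f y) / ((univ.filter fun y => C y = C x).card : ℝ)

/-- The energy of `f` with respect to the partition of the domain into fibres of `C`. -/
noncomputable def fiberEnergy {X K : Type*} [Fintype X] (C : X → K) (f : X → ℝ) : ℝ :=
  ∑ x, fiberAvg C f x ^ 2

lemma fiberAvg_eq {X K : Type*} [Fintype X] {C : X → K} (f : X → ℝ) {x : X} {S : Finset X}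
    (hS : ∀ y, y ∈ S ↔ C y = C x) : fiberAvg C f x = (∑ y ∈ S, f y) / (S.card : ℝ) := by
  have : (univ.filter fun y => C y = C x) = S := by
    ext y; simp [hS]
  rw [fiberAvg, this]

lemma sum_fiberAvg_mul {X K : Type*} [Fintype X] (C : X → K) (f : X → ℝ) (φ : K → ℝ) :
    ∑ x, fiberAvg C f x * φ (C x) = ∑ x, f x * φ (C x) := by
  have h1 : ∀ x, fiberAvg C f x * φ (C x) = ∑ y, if C y = C x then
      f y * φ (C y) / ((univ.filter fun z => C z = C y).card : ℝ) else 0 := by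
    intro x
    rw [fiberAvg, ← Finset.sum_filter, Finset.sum_div, Finset.sum_mul]
    refine Finset.sum_congr rfl fun y hy => ?_
    rw [(Finset.mem_filter.1 hy).2]
    ring
  simp_rw [h1]
  rw [Finset.sum_comm]
  refine Finset.sum_congr rfl fun y _ => ?_
  have h2 : (univ.filter fun x => C y = C x) = univ.filter fun x => C x = C y := by
    ext x; simp [eq_comm]
  have hpos : ((univ.filter fun z => C z = C y).card : ℝ) ≠ 0 := by
    have : y ∈ univ.filter fun z => C z = C y := by simp
    exact_mod_cast (Finset.card_pos.2 ⟨y, this⟩).ne'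
  rw [← Finset.sum_filter, Finset.sum_const, h2, nsmul_eq_mul]
  field_simp

lemma sum_fiberAvg_of_saturated {X K : Type*} [Fintype X] (C : X → K) (f : X → ℝ)
    (S : Finset X) (p : K → Prop) (hS : ∀ x, x ∈ S ↔ p (C x)) :
    ∑ x ∈ S, fiberAvg C f x = ∑ x ∈ S, f x := by
  have h := sum_fiberAvg_mul C f (fun a => if p a then 1 else 0)
  have hS' : S = univ.filter fun x => p (C x) := by
    ext x; simp [hS]
  simp only [mul_ite, mul_one, mul_zero, ← Finset.sum_filter] at h
  rw [hS']
  exact h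

lemma sum_sq_fiberAvg_sub {X K L : Type*} [Fintype X] (C : X → K) (D : X → L) (r : L → K)
    (hr : ∀ x, C x = r (D x)) (f : X → ℝ) :
    ∑ x, (fiberAvg D f x - fiberAvg C f x) ^ 2 = fiberEnergy D f - fiberEnergy C f := by
  let ψ : K → ℝ := fun a => (∑ y with C y = a, f y) / ((univ.filter fun y => C y = a).card : ℝ)
  have h1 : ∑ x, fiberAvg D f x * fiberAvg C f x = ∑ x, f x * fiberAvg C f x := by
    have h := sum_fiberAvg_mul D f (fun l => ψ (r l))
    simp only [← hr] at h
    exact h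
  have h2 : ∑ x, fiberAvg C f x * fiberAvg C f x = ∑ x, f x * fiberAvg C f x :=
    sum_fiberAvg_mul C f ψ
  have h3 : ∀ x, (fiberAvg D f x - fiberAvg C f x) ^ 2 = fiberAvg D f x ^ 2
      - 2 * (fiberAvg D f x * fiberAvg C f x) + fiberAvg C f x * fiberAvg C f x :=
    fun x => by ring
  simp_rw [fiberEnergy, h3, Finset.sum_add_distrib, Finset.sum_sub_distrib, ← Finset.mul_sum]
  simp_rw [pow_two (fiberAvg C f _)]
  rw [h1, h2]
  ring

lemma fiberEnergy_mono {X K L : Type*} [Fintype X] (C : X → K) (D : X → L) (r : L → K)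
    (hr : ∀ x, C x = r (D x)) (f : X → ℝ) : fiberEnergy C f ≤ fiberEnergy D f := by
  have h := sum_sq_fiberAvg_sub C D r hr f
  have : 0 ≤ ∑ x, (fiberAvg D f x - fiberAvg C f x) ^ 2 :=
    Finset.sum_nonneg fun _ _ => sq_nonneg _
  linarith

lemma fiberEnergy_nonneg {X K : Type*} [Fintype X] (C : X → K) (f : X → ℝ) :
    0 ≤ fiberEnergy C f :=
  Finset.sum_nonneg fun _ _ => sq_nonneg _

lemma fiberEnergy_le_sum_sq {X K : Type*} [Fintype X] (C : X → K) (f : X → ℝ) :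
    fiberEnergy C f ≤ ∑ x, f x ^ 2 := by
  refine (fiberEnergy_mono C id C (fun _ => rfl) f).trans_eq ?_
  have h : ∀ x, fiberAvg id f x = f x := fun x => by
    rw [fiberAvg_eq f (S := {x}) (by simp)]
    simp
  simp [fiberEnergy, h]

/-! ### Colourings of almost maximal energy -/

/-- The energy of `f` with respect to the boxes spanned by a vertex colouring `c`. -/
noncomputable def boxEnergy {V K : Type*} [Fintype V] {k : ℕ} (f : (Fin k → V) → ℝ)
    (c : V → K) : ℝ :=
  fiberEnergy (fun x : Fin k → V => c ∘ x) f

lemma boxEnergy_mono {V K L : Type*} [Fintype V] {k : ℕ} (f : (Fin k → V) → ℝ)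
    (c : V → K) (d : V → L) (r : L → K) (hr : ∀ v, c v = r (d v)) :
    boxEnergy f c ≤ boxEnergy f d :=
  fiberEnergy_mono (fun x : Fin k → V => c ∘ x) (fun x : Fin k → V => d ∘ x) (fun y => r ∘ y)
    (fun x => funext fun j => hr (x j)) f

lemma exists_boxEnergy_le_of_card_le {V K : Type*} [Fintype V] [Fintype K] [Nonempty K] {k m : ℕ}
    (f : (Fin k → V) → ℝ) (c : V → K) (hK : Fintype.card K ≤ m) :
    ∃ d : V → Fin m, boxEnergy f c ≤ boxEnergy f d := by
  obtain ⟨j⟩ : Nonempty (K ↪ Fin m) :=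
    Function.Embedding.nonempty_of_card_le (by simpa using hK)
  exact ⟨j ∘ c, boxEnergy_mono f c _ (Function.invFun j)
    fun v => (Function.leftInverse_invFun j.injective (c v)).symm⟩

lemma exists_boxEnergy_stable {V : Type*} [Fintype V] {k : ℕ} (f : (Fin k → V) → ℝ)
    (m : ℕ → ℕ) (hm : ∀ i, 0 < m i) (B δ : ℝ) (N : ℕ)
    (hB : ∑ x, f x ^ 2 ≤ B) (hN : B < N * δ) :
    ∃ i < N, ∃ c : V → Fin (m i), ∀ d : V → Fin (m (i + 1)),
      boxEnergy f d < boxEnergy f c + δ := by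
  have hmax : ∀ i, ∃ c : V → Fin (m i), ∀ d : V → Fin (m i), boxEnergy f d ≤ boxEnergy f c := by
    intro i
    have : Nonempty (Fin (m i)) := ⟨⟨0, hm i⟩⟩
    obtain ⟨c, -, hc⟩ := Finset.exists_max_image (univ : Finset (V → Fin (m i)))
      (boxEnergy f) univ_nonempty
    exact ⟨c, fun d => hc d (mem_univ d)⟩
  choose c hc using hmax
  by_contra! hcon
  have hgrow : ∀ i ≤ N, i * δ ≤ boxEnergy f (c i) := by
    intro i
    induction i with
    | zero =>
      intro _
      rw [Nat.cast_zero, zero_mul]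
      exact fiberEnergy_nonneg _ f
    | succ i ih =>
      intro hi
      obtain ⟨d, hd⟩ := hcon i hi (c i)
      have := hc (i + 1) d
      have := ih (by omega)
      push_cast
      linarith
  have h1 := hgrow N le_rfl
  have h2 : boxEnergy f (c N) ≤ ∑ x, f x ^ 2 := fiberEnergy_le_sum_sq _ f
  linarith

/-! ### Cutting colour classes into blocks of equal size -/

lemma exists_monochromatic_blocks {n m : ℕ} (c : Fin n → Fin m) (s : ℕ) (hs : 0 < s) :
    ∃ (t : ℕ) (P : Fin t → Finset (Fin n)),
      (∀ i j, i ≠ j → Disjoint (P i) (P j)) ∧ (∀ i, (P i).card = s) ∧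
      (∃ a : Fin t → Fin m, ∀ i, ∀ v ∈ P i, c v = a i) ∧
      (univ \ univ.biUnion P).card ≤ m * s := by
  let good : Finset (Finset (Fin n)) → Prop := fun F =>
    (∀ A ∈ F, ∀ B ∈ F, A ≠ B → Disjoint A B) ∧ ∀ A ∈ F, A.card = s ∧ ∃ a, ∀ v ∈ A, c v = a
  obtain ⟨F, hF, hmax⟩ := Finset.exists_max_image
    ((univ : Finset (Finset (Finset (Fin n)))).filter good) Finset.card
    ⟨∅, by simp [good]⟩
  obtain ⟨hdisj, hF⟩ : good F := (Finset.mem_filter.1 hF).2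
  let e := F.equivFin.symm
  have hcol : ∀ i, ∃ a, ∀ v ∈ (e i : Finset (Fin n)), c v = a := fun i => (hF _ (e i).2).2
  choose a ha using hcol
  refine ⟨F.card, fun i => (e i : Finset (Fin n)), fun i j hij => ?_, fun i => (hF _ (e i).2).1,
    ⟨a, ha⟩, ?_⟩
  · exact hdisj _ (e i).2 _ (e j).2 fun h => hij (e.injective (Subtype.ext h))
  set R : Finset (Fin n) := univ \ univ.biUnion fun i => (e i : Finset (Fin n)) with hR
  have hRF : ∀ A ∈ F, Disjoint R A := by
    intro A hA
    rw [Finset.disjoint_left]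
    intro v hv hvA
    refine (Finset.mem_sdiff.1 hv).2 (Finset.mem_biUnion.2 ⟨e.symm ⟨A, hA⟩, mem_univ _, ?_⟩)
    simpa using hvA
  have hsmall : ∀ b, (R.filter fun v => c v = b).card ≤ s := by
    intro b
    by_contra! hb
    obtain ⟨A, hAR, hAs⟩ := Finset.exists_subset_card_eq hb.le
    have hAd : ∀ B ∈ F, Disjoint A B := fun B hB =>
      (hRF B hB).mono_left (hAR.trans (Finset.filter_subset _ _))
    have hAF : A ∉ F := by
      intro hA
      have := (disjoint_self.1 (hAd A hA))
      have : A.card = 0 := Finset.card_eq_zero.2 this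
      omega
    have hgood : good (insert A F) := by
      refine ⟨?_, ?_⟩
      · intro B hB B' hB' hne
        rcases Finset.mem_insert.1 hB with h | h <;>
        rcases Finset.mem_insert.1 hB' with h' | h'
        · exact absurd (h.trans h'.symm) hne
        · exact h ▸ hAd _ h'
        · exact h' ▸ (hAd _ h).symm
        · exact hdisj _ h _ h' hne
      · intro B hB
        rcases Finset.mem_insert.1 hB with rfl | hB
        · exact ⟨hAs, b, fun v hv => (Finset.mem_filter.1 (hAR hv)).2⟩
        · exact hF _ hB
    have := hmax _ (Finset.mem_filter.2 ⟨mem_univ _, hgood⟩)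
    rw [Finset.card_insert_of_notMem hAF] at this
    omega
  have := Finset.card_le_mul_card_image_of_maps_to (s := R) (t := univ) (f := c)
    (fun _ _ => mem_univ _) s (fun b _ => hsmall b)
  simpa [mul_comm] using this

/-! ### Edge counts as sums over boxes -/

/-- The indicator of the ordered tuples spanning an edge. -/
noncomputable def edgeIndicator {n : ℕ} (k : ℕ) (E : Finset (Finset (Fin n)))
    (x : Fin k → Fin n) : ℝ :=
  if univ.image x ∈ E then 1 else 0

lemma sum_sq_edgeIndicator_le {n : ℕ} (k : ℕ) (E : Finset (Finset (Fin n))) :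
    ∑ x, edgeIndicator k E x ^ 2 ≤ (n : ℝ) ^ k := by
  calc ∑ x, edgeIndicator k E x ^ 2 ≤ ∑ _x : Fin k → Fin n, (1 : ℝ) := by
        refine Finset.sum_le_sum fun x _ => ?_
        unfold edgeIndicator
        split_ifs <;> simp
    _ = (n : ℝ) ^ k := by simp

lemma eHyp_eq_sum {n k : ℕ} (E : Finset (Finset (Fin n))) (hE : ∀ e ∈ E, e.card = k)
    (A : Fin k → Finset (Fin n)) (hA : ∀ i j, i ≠ j → Disjoint (A i) (A j)) :
    (eHyp E A : ℝ) = ∑ x ∈ Fintype.piFinset A, edgeIndicator k E x := by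
  have huniq : ∀ i j v, v ∈ A i → v ∈ A j → i = j := by
    intro i j v hi hj
    by_contra hij
    exact Finset.disjoint_left.1 (hA i j hij) hi hj
  simp only [edgeIndicator, Finset.sum_boole]
  rw [eHyp]
  norm_cast
  symm
  refine Finset.card_bij (fun x _ => univ.image x) ?_ ?_ ?_
  · intro x hx
    obtain ⟨hx, hxE⟩ := Finset.mem_filter.1 hx
    rw [Fintype.mem_piFinset] at hx
    refine Finset.mem_filter.2 ⟨hxE, fun i => Finset.card_eq_one.2 ⟨x i, ?_⟩⟩
    ext v
    simp only [Finset.mem_inter, Finset.mem_image, Finset.mem_univ, true_and,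
      Finset.mem_singleton]
    constructor
    · rintro ⟨⟨j, rfl⟩, hv⟩
      rw [huniq _ _ _ (hx j) hv]
    · rintro rfl
      exact ⟨⟨i, rfl⟩, hx i⟩
  · intro x hx y hy hxy
    have hx := Fintype.mem_piFinset.1 (Finset.mem_filter.1 hx).1
    have hy := Fintype.mem_piFinset.1 (Finset.mem_filter.1 hy).1
    funext j
    have : x j ∈ univ.image y := by
      rw [← hxy]
      exact Finset.mem_image_of_mem _ (mem_univ j)
    obtain ⟨i, -, hi⟩ := Finset.mem_image.1 this
    have : i = j := huniq _ _ _ (hy i) (hi ▸ hx j)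
    rw [← hi, this]
  · intro e he
    obtain ⟨heE, he⟩ := Finset.mem_filter.1 he
    have hne : ∀ i, ∃ v, v ∈ e ∩ A i := fun i => Finset.card_pos.1 (by rw [he i]; exact one_pos)
    choose x hx using hne
    simp only [Finset.mem_inter] at hx
    have hinj : Function.Injective x := fun i j hij =>
      huniq i j (x i) (hx i).2 (hij ▸ (hx j).2)
    have himg : univ.image x = e := by
      refine Finset.eq_of_subset_of_card_le ?_ ?_
      · intro v hv
        obtain ⟨i, -, rfl⟩ := Finset.mem_image.1 hv
        exact (hx i).1
      · rw [hE e heE, Finset.card_image_of_injective _ hinj]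
        simp
    exact ⟨x, Finset.mem_filter.2 ⟨Fintype.mem_piFinset.2 fun i => (hx i).2, himg ▸ heE⟩, himg⟩

/-! ### Irregular tuples force an energy increment -/

lemma exists_witness_of_not_epsRegular {n k : ℕ} {ε : ℝ} (hε : 0 < ε)
    {E : Finset (Finset (Fin n))} {W : Fin k → Finset (Fin n)} (h : ¬ EpsRegular ε E W) :
    ∃ A : Fin k → Finset (Fin n), (∀ i, A i ⊆ W i) ∧
      (∀ i, ε * ((W i).card : ℝ) ≤ ((A i).card : ℝ)) ∧
      ε / 2 ≤ |densHyp E A - densHyp E W| := by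
  by_contra! hcon
  refine h ⟨densHyp E W + ε / 2, ?_, fun A hAW hA => ?_⟩
  · have : 0 ≤ densHyp E W := by unfold densHyp; positivity
    linarith
  · have := abs_lt.1 (hcon A hAW hA)
    exact abs_le.2 ⟨by linarith, by linarith⟩

lemma EpsRegular.mono {n k : ℕ} {ε ε' : ℝ} (h : ε ≤ ε') {E : Finset (Finset (Fin n))}
    {W : Fin k → Finset (Fin n)} (hW : EpsRegular ε E W) : EpsRegular ε' E W := by
  obtain ⟨d, hd, hreg⟩ := hW
  refine ⟨d, hd, fun A hAW hA => (hreg A hAW fun i => ?_).trans h⟩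
  exact (mul_le_mul_of_nonneg_right h (Nat.cast_nonneg _)).trans (hA i)

lemma sq_mul_card_le_sum_sq {X : Type*} (B : Finset X) (g : X → ℝ) (a η : ℝ) (hη : 0 ≤ η)
    (ha : η ≤ |a|) (h : ∑ x ∈ B, g x = a * B.card) :
    η ^ 2 * B.card ≤ ∑ x ∈ B, g x ^ 2 := by
  rcases B.eq_empty_or_nonempty with rfl | hB
  · simp
  have hpos : (0 : ℝ) < B.card := by exact_mod_cast Finset.card_pos.2 hB
  have hcs := sq_sum_le_card_mul_sum_sq (s := B) (f := g)
  rw [h] at hcs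
  have h1 : η ^ 2 ≤ a ^ 2 := by
    rw [← sq_abs a]
    exact pow_le_pow_left₀ hη ha 2
  have h2 : a ^ 2 * B.card ≤ ∑ x ∈ B, g x ^ 2 := by
    refine le_of_mul_le_mul_left ?_ hpos
    linarith [hcs]
  exact (mul_le_mul_of_nonneg_right h1 hpos.le).trans h2

lemma densHyp_mul_card {n k : ℕ} (E : Finset (Finset (Fin n))) (hE : ∀ e ∈ E, e.card = k)
    (A : Fin k → Finset (Fin n)) (hA : ∀ i j, i ≠ j → Disjoint (A i) (A j)) :
    densHyp E A * (Fintype.piFinset A).card = ∑ x ∈ Fintype.piFinset A, edgeIndicator k E x := by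
  rcases (Fintype.piFinset A).eq_empty_or_nonempty with h | h
  · simp [h]
  have hpos : ((Fintype.piFinset A).card : ℝ) ≠ 0 := by
    exact_mod_cast (Finset.card_pos.2 h).ne'
  rw [← eHyp_eq_sum E hE A hA, densHyp, ← Nat.cast_prod, ← Fintype.card_piFinset]
  field_simp

/-- Refining a colouring having the disjoint sets `P i` among its classes by witnesses of
irregularity of the tuples in `T` increases the energy proportionally to `T.card`. -/
lemma boxEnergy_add_le_of_irregular {n k t s : ℕ} {ε : ℝ} (hε : 0 < ε)
    (E : Finset (Finset (Fin n))) (hE : ∀ e ∈ E, e.card = k)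
    (P : Fin t → Finset (Fin n)) (hP : ∀ i j, i ≠ j → Disjoint (P i) (P j))
    (hPs : ∀ i, (P i).card = s)
    {K : Type} [Fintype K] (q : Fin n → K) (p : Fin t → K) (hq : ∀ i v, q v = p i ↔ v ∈ P i)
    (T : Finset (Fin k ↪ Fin t)) (hT : ∀ f ∈ T, ¬ EpsRegular ε E fun i => P (f i)) :
    ∃ d : Fin n → K × ((Fin k ↪ Fin t) → Fin k → Prop),
      boxEnergy (edgeIndicator k E) q + T.card * ((ε / 2) ^ 2 * (ε * s) ^ k) ≤
        boxEnergy (edgeIndicator k E) d := by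
  have hwit : ∀ f : Fin k ↪ Fin t, ∃ A : Fin k → Finset (Fin n), f ∈ T →
      (∀ i, A i ⊆ P (f i)) ∧ (∀ i, ε * ((P (f i)).card : ℝ) ≤ ((A i).card : ℝ)) ∧
      ε / 2 ≤ |densHyp E A - densHyp E fun i => P (f i)| := by
    intro f
    by_cases hf : f ∈ T
    · obtain ⟨A, hA⟩ := exists_witness_of_not_epsRegular hε (hT f hf)
      exact ⟨A, fun _ => hA⟩
    · exact ⟨fun _ => ∅, fun h => absurd h hf⟩
  choose A hA using hwit
  let d : Fin n → K × ((Fin k ↪ Fin t) → Fin k → Prop) := fun v => (q v, fun f j => v ∈ A f j)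
  refine ⟨d, ?_⟩
  set φ := edgeIndicator k E with hφ
  let C : (Fin k → Fin n) → (Fin k → K) := fun x => q ∘ x
  let D : (Fin k → Fin n) → (Fin k → K × ((Fin k ↪ Fin t) → Fin k → Prop)) := fun x => d ∘ x
  have hpyth : ∑ x, (fiberAvg D φ x - fiberAvg C φ x) ^ 2 = boxEnergy φ d - boxEnergy φ q :=
    sum_sq_fiberAvg_sub C D (fun y j => (y j).1) (fun _ => rfl) φ
  have hbox : ∀ f ∈ T, (ε / 2) ^ 2 * (ε * s) ^ k ≤
      ∑ x ∈ Fintype.piFinset (A f), (fiberAvg D φ x - fiberAvg C φ x) ^ 2 := by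
    intro f hf
    obtain ⟨hAP, hAcard, hdev⟩ := hA f hf
    have hPd : ∀ i j, i ≠ j → Disjoint (P (f i)) (P (f j)) :=
      fun i j hij => hP _ _ fun h => hij (f.injective h)
    have hAd : ∀ i j, i ≠ j → Disjoint (A f i) (A f j) :=
      fun i j hij => (hPd i j hij).mono (hAP i) (hAP j)
    have hD : ∑ x ∈ Fintype.piFinset (A f), fiberAvg D φ x =
        densHyp E (A f) * (Fintype.piFinset (A f)).card := by
      rw [densHyp_mul_card E hE _ hAd]
      exact sum_fiberAvg_of_saturated D φ _ (fun y => ∀ j, (y j).2 f j)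
        fun x => Fintype.mem_piFinset
    have hC : ∀ x ∈ Fintype.piFinset (A f),
        fiberAvg C φ x = densHyp E fun i => P (f i) := by
      intro x hx
      have hx := Fintype.mem_piFinset.1 hx
      have hfib : ∀ y, y ∈ Fintype.piFinset (fun i => P (f i)) ↔ C y = C x := by
        intro y
        simp only [Fintype.mem_piFinset, funext_iff, C, Function.comp]
        refine forall_congr' fun j => ?_
        rw [(hq (f j) (x j)).2 (hAP j (hx j)), hq]
      rw [fiberAvg_eq φ hfib, hφ, ← eHyp_eq_sum E hE _ hPd, densHyp, Fintype.card_piFinset,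
        Nat.cast_prod]
    have hsum : ∑ x ∈ Fintype.piFinset (A f), (fiberAvg D φ x - fiberAvg C φ x) =
        (densHyp E (A f) - densHyp E fun i => P (f i)) * (Fintype.piFinset (A f)).card := by
      rw [Finset.sum_sub_distrib, hD, Finset.sum_congr rfl hC, Finset.sum_const, nsmul_eq_mul]
      ring
    refine le_trans ?_ (sq_mul_card_le_sum_sq _ _ _ (ε / 2) (by positivity) hdev hsum)
    refine mul_le_mul_of_nonneg_left ?_ (by positivity)
    rw [Fintype.card_piFinset, Nat.cast_prod]
    calc (ε * s) ^ k = ∏ _i : Fin k, ε * (s : ℝ) := by simp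
      _ ≤ ∏ i, ((A f i).card : ℝ) :=
        Finset.prod_le_prod (fun _ _ => by positivity) fun i _ => by
          simpa [hPs] using hAcard i
  have hdisj : (T : Set (Fin k ↪ Fin t)).PairwiseDisjoint fun f => Fintype.piFinset (A f) := by
    intro f hf g hg hfg
    refine Finset.disjoint_left.2 fun x hxf hxg => hfg ?_
    have hxf := Fintype.mem_piFinset.1 hxf
    have hxg := Fintype.mem_piFinset.1 hxg
    refine DFunLike.ext _ _ fun j => ?_
    by_contra hne
    exact Finset.disjoint_left.1 (hP _ _ hne) ((hA f hf).1 j (hxf j)) ((hA g hg).1 j (hxg j))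
  have htotal : T.card * ((ε / 2) ^ 2 * (ε * s) ^ k) ≤
      ∑ x, (fiberAvg D φ x - fiberAvg C φ x) ^ 2 := by
    calc T.card * ((ε / 2) ^ 2 * (ε * s) ^ k)
        = ∑ _f ∈ T, (ε / 2) ^ 2 * (ε * s) ^ k := by rw [Finset.sum_const, nsmul_eq_mul]
      _ ≤ ∑ f ∈ T, ∑ x ∈ Fintype.piFinset (A f), (fiberAvg D φ x - fiberAvg C φ x) ^ 2 :=
        Finset.sum_le_sum hbox
      _ = ∑ x ∈ T.biUnion fun f => Fintype.piFinset (A f),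
            (fiberAvg D φ x - fiberAvg C φ x) ^ 2 := (Finset.sum_biUnion hdisj).symm
      _ ≤ _ := Finset.sum_le_sum_of_subset_of_nonneg (Finset.subset_univ _)
        fun _ _ _ => sq_nonneg _
  linarith

/-! ### The regularity lemma -/

lemma pow_half_le_factorial_mul_choose {t k : ℕ} (h : 2 * k ≤ t) :
    ((t : ℝ) / 2) ^ k ≤ k.factorial * t.choose k := by
  have h1 : ((t + 1 - k : ℕ) ^ k : ℕ) ≤ k.factorial * t.choose k := by
    rw [← Nat.descFactorial_eq_factorial_mul_choose]
    exact Nat.pow_sub_le_descFactorial t k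
  have h2 : ((t + 1 - k : ℕ) : ℝ) ^ k ≤ k.factorial * t.choose k := by exact_mod_cast h1
  refine le_trans (pow_le_pow_left₀ (by positivity) ?_ k) h2
  have : (t : ℝ) ≤ 2 * ((t + 1 - k : ℕ) : ℝ) := by exact_mod_cast (by omega)
  linarith

/-- Blocks of size `n / blockBound k t₀ ε m` are cut out of the classes of an `m`-colouring. -/
noncomputable def blockBound (k t₀ : ℕ) (ε : ℝ) (m : ℕ) : ℕ :=
  m * ⌈1 / ε⌉₊ + 2 * (t₀ + 2 * k)

/-- The number of colours after refining the blocks by witnesses of irregularity. -/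
noncomputable def refineBound (k t₀ : ℕ) (ε : ℝ) (m : ℕ) : ℕ :=
  (2 * blockBound k t₀ ε m + m) *
    (2 ^ k) ^ (2 * blockBound k t₀ ε m) ^ k

lemma exists_blocks_of_stable {n k t₀ m : ℕ} (ht₀ : 1 ≤ t₀) {ε : ℝ} (hε : 0 < ε)
    (hε2 : ε ≤ 1 / 2) (hm : 0 < m) (hn : blockBound k t₀ ε m ≤ n)
    (E : Finset (Finset (Fin n))) (hE : ∀ e ∈ E, e.card = k) (c : Fin n → Fin m)
    (hc : ∀ d : Fin n → Fin (refineBound k t₀ ε m), boxEnergy (edgeIndicator k E) d <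
      boxEnergy (edgeIndicator k E) c + ε ^ (k + 3) / (4 * 4 ^ k * k.factorial) * (n : ℝ) ^ k) :
    ∃ t : ℕ, t₀ ≤ t ∧ t ≤ 2 * blockBound k t₀ ε m ∧
      ∃ (V0 : Finset (Fin n)) (P : Fin t → Finset (Fin n)),
        (∀ i, Disjoint V0 (P i)) ∧
        (∀ i j, i ≠ j → Disjoint (P i) (P j)) ∧
        (V0 ∪ Finset.univ.biUnion P = Finset.univ) ∧
        (∀ i j, (P i).card = (P j).card) ∧
        ((V0.card : ℝ) ≤ ε * n) ∧
        (((((Finset.univ : Finset (Fin t)).powersetCard k).filter fun S =>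
            ¬ ∃ f : Fin k ↪ Fin t, Finset.univ.map f = S ∧
              EpsRegular ε E fun i => P (f i)).card : ℝ) ≤
          ε * (Nat.choose t k)) := by
  set M := blockBound k t₀ ε m with hM
  have hMt : 2 * (t₀ + 2 * k) ≤ M := by simp [hM, blockBound]
  have hMpos : 0 < M := by omega
  have hmM : (m : ℝ) ≤ ε * M := by
    have h1 : 1 / ε ≤ (⌈1 / ε⌉₊ : ℝ) := Nat.le_ceil _
    have h2 : (m : ℝ) * ⌈1 / ε⌉₊ ≤ M := by
      have : m * ⌈1 / ε⌉₊ ≤ M := by simp [hM, blockBound]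
      exact_mod_cast this
    have h3 : (1 : ℝ) ≤ ε * ⌈1 / ε⌉₊ := by
      rw [div_le_iff₀ hε] at h1
      linarith
    calc (m : ℝ) = m * 1 := (mul_one _).symm
      _ ≤ m * (ε * ⌈1 / ε⌉₊) := by gcongr
      _ = ε * (m * ⌈1 / ε⌉₊) := by ring
      _ ≤ ε * M := by gcongr
  set s := n / M with hs
  have hspos : 0 < s := Nat.div_pos hn hMpos
  have hsM : s * M ≤ n := Nat.div_mul_le_self n M
  have hnlt : n < (s + 1) * M := by
    rw [hs, mul_comm]
    exact Nat.lt_mul_div_succ n hMpos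
  obtain ⟨t, P, hP, hPs, ⟨a, ha⟩, hleft⟩ := exists_monochromatic_blocks c s hspos
  have hcover : (univ \ univ.biUnion P).card + t * s = n := by
    have h1 : (univ.biUnion P).card = t * s := by
      rw [Finset.card_biUnion fun i _ j _ hij => hP i j hij]
      simp [hPs]
    have h2 := Finset.card_sdiff_add_card_eq_card (Finset.subset_univ (univ.biUnion P))
    rw [h1] at h2
    simpa using h2
  have hms : (m : ℝ) * s ≤ ε * n := by
    calc (m : ℝ) * s ≤ ε * M * s := by gcongr
      _ = ε * ((s * M : ℕ) : ℝ) := by push_cast; ring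
      _ ≤ ε * n := by gcongr
  have hleft' : ((univ \ univ.biUnion P).card : ℝ) ≤ ε * n :=
    le_trans (by exact_mod_cast hleft) hms
  have hts : (n : ℝ) / 2 ≤ t * s := by
    have h1 : ((univ \ univ.biUnion P).card : ℝ) + t * s = n := by exact_mod_cast hcover
    have h2 : ε * (n : ℝ) ≤ 1 / 2 * n := by gcongr
    linarith
  have htlow : t₀ + 2 * k ≤ t := by
    have h1 : n ≤ 2 * (t * s) := by
      have : (n : ℝ) ≤ 2 * (t * s) := by linarith
      exact_mod_cast this
    have h2 : s * M ≤ s * (2 * t) := by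
      calc s * M ≤ n := hsM
        _ ≤ 2 * (t * s) := h1
        _ = s * (2 * t) := by ring
    have := Nat.le_of_mul_le_mul_left h2 hspos
    omega
  have htup : t ≤ 2 * M := by
    have h1 : s * t ≤ s * (2 * M) := by
      calc s * t = t * s := mul_comm _ _
        _ ≤ n := by omega
        _ ≤ (s + 1) * M := hnlt.le
        _ ≤ (2 * s) * M := Nat.mul_le_mul_right _ (by omega)
        _ = s * (2 * M) := by ring
    exact Nat.le_of_mul_le_mul_left h1 hspos
  refine ⟨t, by omega, htup, univ \ univ.biUnion P, P, fun i => ?_, hP, ?_, fun i j => ?_,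
    hleft', ?_⟩
  · exact Finset.sdiff_disjoint.mono_right (Finset.subset_biUnion_of_mem P (mem_univ i))
  · exact Finset.sdiff_union_of_subset (Finset.subset_univ _)
  · rw [hPs, hPs]
  by_contra hcon
  have hbad := not_le.1 hcon
  set S := ((Finset.univ : Finset (Fin t)).powersetCard k).filter fun S =>
    ¬ ∃ f : Fin k ↪ Fin t, Finset.univ.map f = S ∧ EpsRegular ε E fun i => P (f i) with hS
  let g : Finset (Fin t) → (Fin k ↪ Fin t) := fun I =>
    if h : I.card = k then (I.orderEmbOfFin h).toEmbedding
    else Fin.castLEEmb (by omega)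
  have hg : ∀ I ∈ S, univ.map (g I) = I := by
    intro I hI
    have hcard : I.card = k := (Finset.mem_powersetCard.1 (Finset.mem_filter.1 hI).1).2
    simp only [g, dif_pos hcard]
    exact Finset.map_orderEmbOfFin_univ I hcard
  have hginj : Set.InjOn g S := fun I hI J hJ h => by rw [← hg I hI, ← hg J hJ, h]
  have hT : ∀ f ∈ S.image g, ¬ EpsRegular ε E fun i => P (f i) := by
    intro f hf hreg
    obtain ⟨I, hI, rfl⟩ := Finset.mem_image.1 hf
    exact (Finset.mem_filter.1 hI).2 ⟨g I, hg I hI, hreg⟩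
  let q : Fin n → Fin t ⊕ Fin m := fun v =>
    if h : ∃ i, v ∈ P i then Sum.inl h.choose else Sum.inr (c v)
  have hq : ∀ i v, q v = Sum.inl i ↔ v ∈ P i := by
    intro i v
    by_cases h : ∃ i, v ∈ P i
    · simp only [q, dif_pos h, Sum.inl.injEq]
      constructor
      · intro hi
        exact hi ▸ h.choose_spec
      · intro hv
        by_contra hne
        exact Finset.disjoint_left.1 (hP _ _ hne) h.choose_spec hv
    · simp only [q, dif_neg h, reduceCtorEq, false_iff]
      exact fun hv => h ⟨i, hv⟩
  have hcq : boxEnergy (edgeIndicator k E) c ≤ boxEnergy (edgeIndicator k E) q := by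
    refine boxEnergy_mono _ c q (Sum.elim a id) fun v => ?_
    by_cases h : ∃ i, v ∈ P i
    · simp only [q, dif_pos h, Sum.elim_inl]
      exact ha _ v h.choose_spec
    · simp [q, dif_neg h]
  obtain ⟨d, hd⟩ := boxEnergy_add_le_of_irregular hε E hE P hP hPs q Sum.inl hq (S.image g) hT
  rw [Finset.card_image_of_injOn hginj] at hd
  have hcard : Fintype.card ((Fin t ⊕ Fin m) × ((Fin k ↪ Fin t) → Fin k → Prop)) ≤
      refineBound k t₀ ε m := by
    have h1 : Fintype.card (Fin k ↪ Fin t) ≤ (2 * M) ^ k := by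
      calc Fintype.card (Fin k ↪ Fin t) ≤ Fintype.card (Fin k → Fin t) :=
            Fintype.card_le_of_injective _ DFunLike.coe_injective
        _ = t ^ k := by simp
        _ ≤ (2 * M) ^ k := Nat.pow_le_pow_left htup k
    rw [Fintype.card_prod, Fintype.card_sum, Fintype.card_fun, Fintype.card_fun,
      Fintype.card_fin, Fintype.card_fin, Fintype.card_fin, Fintype.card_prop, refineBound]
    exact Nat.mul_le_mul (by omega) (Nat.pow_le_pow_right (by positivity) h1)
  have : Nonempty (Fin m) := ⟨⟨0, hm⟩⟩
  obtain ⟨d', hd'⟩ := exists_boxEnergy_le_of_card_le (edgeIndicator k E) d hcard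
  have hlt := hc d'
  have hgain : ε ^ (k + 3) / (4 * 4 ^ k * k.factorial) * (n : ℝ) ^ k ≤
      S.card * ((ε / 2) ^ 2 * (ε * s) ^ k) := by
    have hfac : (0 : ℝ) < k.factorial := by exact_mod_cast k.factorial_pos
    have h1 : ((n : ℝ) / 4) ^ k ≤ k.factorial * t.choose k * (s : ℝ) ^ k := by
      calc ((n : ℝ) / 4) ^ k ≤ ((t : ℝ) / 2 * s) ^ k :=
            pow_le_pow_left₀ (by positivity) (by linarith) k
        _ = ((t : ℝ) / 2) ^ k * (s : ℝ) ^ k := mul_pow _ _ _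
        _ ≤ _ := by
          gcongr
          exact pow_half_le_factorial_mul_choose (by omega)
    calc ε ^ (k + 3) / (4 * 4 ^ k * k.factorial) * (n : ℝ) ^ k
        = ε ^ (k + 3) / (4 * k.factorial) * ((n : ℝ) / 4) ^ k := by
          rw [div_pow]
          field_simp
      _ ≤ ε ^ (k + 3) / (4 * k.factorial) * (k.factorial * t.choose k * (s : ℝ) ^ k) := by
          gcongr
      _ = (ε * t.choose k) * ((ε / 2) ^ 2 * (ε * s) ^ k) := by
          rw [mul_pow, pow_add]
          field_simp
          ring
      _ ≤ S.card * ((ε / 2) ^ 2 * (ε * s) ^ k) := by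
          gcongr
  linarith

/-- The number of colours available after `i` refinements. -/
noncomputable def colourBound (k t₀ : ℕ) (ε : ℝ) : ℕ → ℕ
  | 0 => 1
  | i + 1 => refineBound k t₀ ε (colourBound k t₀ ε i)

lemma colourBound_pos {k t₀ : ℕ} (ε : ℝ) (i : ℕ) :
    0 < colourBound k t₀ ε i := by
  induction i with
  | zero => exact one_pos
  | succ i ih =>
    simp only [colourBound, refineBound]
    positivity

lemma weak_regularity_of_le_half (k t₀ : ℕ) (ht₀ : 1 ≤ t₀) (ε : ℝ) (hε : 0 < ε)
    (hε2 : ε ≤ 1 / 2) :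
    ∃ T₀ : ℕ, ∃ n₀ : ℕ, ∀ n : ℕ, n₀ ≤ n →
      ∀ E : Finset (Finset (Fin n)), (∀ e ∈ E, e.card = k) →
        ∃ t : ℕ, t₀ ≤ t ∧ t ≤ T₀ ∧
          ∃ (V0 : Finset (Fin n)) (P : Fin t → Finset (Fin n)),
            (∀ i, Disjoint V0 (P i)) ∧
            (∀ i j, i ≠ j → Disjoint (P i) (P j)) ∧
            (V0 ∪ Finset.univ.biUnion P = Finset.univ) ∧
            (∀ i j, (P i).card = (P j).card) ∧
            ((V0.card : ℝ) ≤ ε * n) ∧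
            (((((Finset.univ : Finset (Fin t)).powersetCard k).filter fun S =>
                ¬ ∃ f : Fin k ↪ Fin t, Finset.univ.map f = S ∧
                  EpsRegular ε E fun i => P (f i)).card : ℝ) ≤
              ε * (Nat.choose t k)) := by
  set δ : ℝ := ε ^ (k + 3) / (4 * 4 ^ k * k.factorial) with hδ
  have hδpos : 0 < δ := by positivity
  obtain ⟨N, hN⟩ := exists_nat_gt (1 / δ)
  rw [div_lt_iff₀ hδpos] at hN
  let b : ℕ → ℕ := fun i => blockBound k t₀ ε (colourBound k t₀ ε i)
  have hb : ∀ i < N, b i ≤ ∑ j ∈ range N, b j := fun i hi =>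
    Finset.single_le_sum (f := b) (fun _ _ => Nat.zero_le _) (Finset.mem_range.2 hi)
  refine ⟨2 * ∑ j ∈ range N, b j, 1 + ∑ j ∈ range N, b j, fun n hn E hE => ?_⟩
  have hnpos : (0 : ℝ) < (n : ℝ) ^ k := by
    have : 0 < n := by omega
    positivity
  obtain ⟨i, hi, c, hc⟩ := exists_boxEnergy_stable (edgeIndicator k E) (colourBound k t₀ ε)
    (colourBound_pos ε) ((n : ℝ) ^ k) (δ * (n : ℝ) ^ k) N (sum_sq_edgeIndicator_le k E)
    (by nlinarith)
  have hbi := hb i hi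
  obtain ⟨t, ht, htb, h⟩ := exists_blocks_of_stable ht₀ hε hε2 (colourBound_pos ε i)
    (show b i ≤ n by omega) E hE c hc
  exact ⟨t, ht, htb.trans (Nat.mul_le_mul_left 2 hbi), h⟩

theorem stmt16 (k t₀ : ℕ) (hk : 2 ≤ k) (ht₀ : 1 ≤ t₀) (ε : ℝ) (hε : 0 < ε) :
    ∃ T₀ : ℕ, ∃ n₀ : ℕ, ∀ n : ℕ, n₀ ≤ n →
      ∀ E : Finset (Finset (Fin n)), (∀ e ∈ E, e.card = k) →
        ∃ t : ℕ, t₀ ≤ t ∧ t ≤ T₀ ∧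
          ∃ (V0 : Finset (Fin n)) (P : Fin t → Finset (Fin n)),
            (∀ i, Disjoint V0 (P i)) ∧
            (∀ i j, i ≠ j → Disjoint (P i) (P j)) ∧
            (V0 ∪ Finset.univ.biUnion P = Finset.univ) ∧
            (∀ i j, (P i).card = (P j).card) ∧
            ((V0.card : ℝ) ≤ ε * n) ∧
            (((((Finset.univ : Finset (Fin t)).powersetCard k).filter fun S =>
                ¬ ∃ f : Fin k ↪ Fin t, Finset.univ.map f = S ∧
                  EpsRegular ε E fun i => P (f i)).card : ℝ) ≤
              ε * (Nat.choose t k)) := by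
  have hle : min ε (1 / 2) ≤ ε := min_le_left _ _
  obtain ⟨T₀, n₀, h⟩ := weak_regularity_of_le_half k t₀ ht₀ (min ε (1 / 2))
    (lt_min hε (by norm_num)) (min_le_right _ _)
  refine ⟨T₀, n₀, fun n hn E hE => ?_⟩
  obtain ⟨t, ht, htT, V0, P, h0, hP, hcov, hcard, hV0, hirr⟩ := h n hn E hE
  refine ⟨t, ht, htT, V0, P, h0, hP, hcov, hcard,
    hV0.trans (mul_le_mul_of_nonneg_right hle (Nat.cast_nonneg _)), ?_⟩
  refine le_trans ?_ (hirr.trans (mul_le_mul_of_nonneg_right hle (Nat.cast_nonneg _)))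
  refine Nat.cast_le.2 (Finset.card_le_card (Finset.monotone_filter_right _ fun S _ hS => ?_))
  rintro ⟨f, hf, hreg⟩
  exact hS ⟨f, hf, hreg.mono hle⟩
end
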